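/- Fix q ∈ (0,1/2) and a > 0 with a·c₀ ≥ 2. There exists a constant C > 0, independent of ε and n, such that for every ε ∈ (0,1] with aε < q and every integer n ≥ 2, the nonlinear discrete scheme on the Vulanović mesh has a unique solution y, and max_{0≤i≤n} |u(x_i) − y_i| ≤ C n^{−2}, where u is the solution of the continuous problem. -/

import Mathlib

open Set Real

noncomputable section

/-- first partial derivative of `f(x,u)` with respect to `u` -/
def pderiv1 (f : ℝ → ℝ → ℝ) (x y : ℝ) : ℝ := deriv (fun z => f x z) y

/-- second partial derivative of `f(x,u)` with respect to `u` -/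
def pderiv2 (f : ℝ → ℝ → ℝ) (x y : ℝ) : ℝ :=
  deriv (fun z => deriv (fun w => f x w) z) y

/-- `f` is four times continuously differentiable on `[0,1] × ℝ`. -/
def SmoothF (f : ℝ → ℝ → ℝ) : Prop :=
  ContDiffOn ℝ 4 (fun p : ℝ × ℝ => f p.1 p.2) ((Icc (0:ℝ) 1) ×ˢ (univ : Set ℝ))

/-- the stability condition `f_u(x,u) ≥ c₀² > 0` on `[0,1] × ℝ` -/
def LowerF (f : ℝ → ℝ → ℝ) (c₀ : ℝ) : Prop :=
  ∀ x ∈ Icc (0:ℝ) 1, ∀ y : ℝ, c₀ ^ 2 ≤ pderiv1 f x y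

/-- `u` is a C⁴-solution of the semilinear BVP `-ε²u'' + f(x,u) = 0`, `u(0)=u(1)=0`. -/
def IsSolution (f : ℝ → ℝ → ℝ) (ε : ℝ) (u : ℝ → ℝ) : Prop :=
  ContDiffOn ℝ 4 u (Icc (0:ℝ) 1) ∧
  (∀ x ∈ Ioo (0:ℝ) 1,
    -ε ^ 2 * iteratedDerivWithin 2 u (Icc (0:ℝ) 1) x + f x (u x) = 0) ∧
  u 0 = 0 ∧ u 1 = 0

/-- the constant `l = c₀⁻² · max_{[0,1]} |f(x,0)|` -/
def lconst (f : ℝ → ℝ → ℝ) (c₀ : ℝ) : ℝ :=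
  c₀ ^ (-2 : ℤ) * sSup ((fun x => |f x 0|) '' Icc (0:ℝ) 1)

/-- the constant `θ = max { |f_uu(x,ξ)| : x ∈ [0,1], |ξ| ≤ l + 2ρ }` -/
def thconst (f : ℝ → ℝ → ℝ) (c₀ ρ : ℝ) : ℝ :=
  sSup ((fun p : ℝ × ℝ => |pderiv2 f p.1 p.2|) ''
    ((Icc (0:ℝ) 1) ×ˢ (Icc (-(lconst f c₀ + 2*ρ)) (lconst f c₀ + 2*ρ))))

/-- discrete second difference `y_{x̄x̂,i}` on a nonuniform mesh `x` (for `1 ≤ i`),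
using `ℏ_i = (h_i + h_{i+1})/2 = (x_{i+1} - x_{i-1})/2`. -/
def ddiff (x y : ℕ → ℝ) (i : ℕ) : ℝ :=
  2 / (x (i+1) - x (i-1)) *
    ((y (i+1) - y i) / (x (i+1) - x i) - (y i - y (i-1)) / (x i - x (i-1)))

/-- Shishkin mesh generating function with transition parameter
`α = min(1/4, 2γ₀⁻¹ ε ln n)`. -/
def shishkinLam (γ₀ ε : ℝ) (n : ℕ) (t : ℝ) : ℝ :=
  let α := min (1/4) (2 * γ₀⁻¹ * ε * Real.log n)
  if t ≤ 1/4 then 4*α*t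
  else if t ≤ 1/2 then α + 2*(1-2*α)*(t-1/4)
  else 1 - (if 1-t ≤ 1/4 then 4*α*(1-t) else α + 2*(1-2*α)*((1-t)-1/4))

/-- Shishkin mesh nodes `x_i = λ(i/n)` -/
def shishkinMesh (γ₀ ε : ℝ) (n i : ℕ) : ℝ := shishkinLam γ₀ ε n ((i:ℝ)/(n:ℝ))

def bakhPhi (a ε q t : ℝ) : ℝ := a*ε*Real.log (q/(q-t))

/-- derivative of `bakhPhi` -/
def bakhPhi' (a ε q t : ℝ) : ℝ := a*ε/(q-t)

/-- `α ∈ (0,q)` is the abscissa of the contact point of the tangent line from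
`(1/2,1/2)` to `φ`, i.e. `φ(α) + φ'(α)(1/2 - α) = 1/2`. -/
def IsBakhAlpha (a ε q α : ℝ) : Prop :=
  α ∈ Ioo 0 q ∧ bakhPhi a ε q α + bakhPhi' a ε q α * (1/2 - α) = 1/2

/-- Bakhvalov mesh generating function -/
def bakhLam (a ε q α t : ℝ) : ℝ :=
  if t ≤ α then bakhPhi a ε q t
  else if t ≤ 1/2 then bakhPhi a ε q α + bakhPhi' a ε q α * (t-α)
  else 1 - (if 1-t ≤ α then bakhPhi a ε q (1-t)
            else bakhPhi a ε q α + bakhPhi' a ε q α * ((1-t)-α))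

/-- Bakhvalov mesh nodes `x_i = λ(i/n)` -/
def bakhMesh (a ε q α : ℝ) (n i : ℕ) : ℝ := bakhLam a ε q α ((i:ℝ)/(n:ℝ))

def vulAlpha (a ε q : ℝ) : ℝ :=
  (q - Real.sqrt (ε*a*q*(1-2*q+2*ε*a)))/(1+2*ε*a)

def vulMu (a ε q t : ℝ) : ℝ := a*ε*t/(q-t)

/-- derivative of `vulMu` -/
def vulMu' (a ε q t : ℝ) : ℝ := a*ε*q/(q-t)^2

/-- Vulanović mesh generating function -/
def vulLam (a ε q t : ℝ) : ℝ :=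
  let α := vulAlpha a ε q
  if t ≤ α then vulMu a ε q t
  else if t ≤ 1/2 then vulMu a ε q α + vulMu' a ε q α * (t-α)
  else 1 - (if 1-t ≤ α then vulMu a ε q (1-t)
            else vulMu a ε q α + vulMu' a ε q α * ((1-t)-α))

/-- Vulanović mesh nodes `x_i = λ(i/n)` -/
def vulMesh (a ε q : ℝ) (n i : ℕ) : ℝ := vulLam a ε q ((i:ℝ)/(n:ℝ))

/-- the three-point discrete scheme for the linear problem
`-ε² y_{x̄x̂,i} + b(x_i) y_i = g(x_i)`, `y_0 = y_n = 0` -/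
def LinScheme (bc gc : ℝ → ℝ) (ε : ℝ) (x : ℕ → ℝ) (n : ℕ) (y : ℕ → ℝ) : Prop :=
  (∀ i : ℕ, 1 ≤ i → i < n →
    -ε ^ 2 * ddiff x y i + bc (x i) * y i = gc (x i)) ∧
  y 0 = 0 ∧ y n = 0

/-- the nonlinear discrete scheme `-ε² y_{x̄x̂,i} + f(x_i, y_i) = 0`, `y_0 = y_n = 0` -/
def NonlinScheme (f : ℝ → ℝ → ℝ) (ε : ℝ) (x : ℕ → ℝ) (n : ℕ) (y : ℕ → ℝ) : Prop :=
  (∀ i : ℕ, 1 ≤ i → i < n → -ε ^ 2 * ddiff x y i + f (x i) (y i) = 0) ∧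
  y 0 = 0 ∧ y n = 0

/-- `u` is a C²-solution of the continuous linear problem
`-ε²u'' + b(x)u = g(x)`, `u(0)=u(1)=0`. -/
def IsLinSolution (bc gc : ℝ → ℝ) (ε : ℝ) (u : ℝ → ℝ) : Prop :=
  ContDiffOn ℝ 2 u (Icc (0:ℝ) 1) ∧
  (∀ x ∈ Ioo (0:ℝ) 1,
    -ε ^ 2 * iteratedDerivWithin 2 u (Icc (0:ℝ) 1) x + bc x * u x = gc x) ∧
  u 0 = 0 ∧ u 1 = 0

/-- `b(x,ε)` is three times continuously differentiable in `x` on `[0,1]`,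
with these derivatives bounded uniformly in `ε ∈ [0,1]`. -/
def UnifC3 (b : ℝ → ℝ → ℝ) : Prop :=
  ∃ M : ℝ, ∀ ε ∈ Icc (0:ℝ) 1,
    ContDiffOn ℝ 3 (fun x => b x ε) (Icc (0:ℝ) 1) ∧
    ∀ j : ℕ, j ≤ 3 → ∀ x ∈ Icc (0:ℝ) 1,
      |iteratedDerivWithin j (fun x => b x ε) (Icc (0:ℝ) 1) x| ≤ M

/-- `w` is the continuous piecewise-linear interpolant of mesh data `y`
on the mesh `x_0 < … < x_n`. -/
def IsLinInterp (x : ℕ → ℝ) (n : ℕ) (y : ℕ → ℝ) (w : ℝ → ℝ) : Prop :=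
  (∀ i ≤ n, w (x i) = y i) ∧
  ∀ i < n, ∀ t ∈ Icc (x i) (x (i+1)),
    w t = y i + (y (i+1) - y i) * (t - x i) / (x (i+1) - x i)

/-- properties of the initial guess `u⁰`: of class C³, within `ρ` of the
solution `u`, and satisfying ε-uniform bounds of layer type for `j = 0, 1`. -/
def InitGuess (c₀ ε C₀ ρ : ℝ) (u u0 : ℝ → ℝ) : Prop :=
  ContDiffOn ℝ 3 u0 (Icc (0:ℝ) 1) ∧
  (∀ x ∈ Icc (0:ℝ) 1, |u0 x - u x| ≤ ρ) ∧
  (∀ x ∈ Icc (0:ℝ) 1, |u0 x| ≤ C₀) ∧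
  (∀ x ∈ Icc (0:ℝ) 1, |derivWithin u0 (Icc (0:ℝ) 1) x| ≤
    C₀ * (1 + ε⁻¹ * (Real.exp (-c₀*x/ε) + Real.exp (-c₀*(1-x)/ε))))

/-- the discrete Newton (quasilinearization) iterates on the mesh `x`:
`y⁰_i = u⁰(x_i)` and `y^{m+1}` solves the quasilinearized discrete problem. -/
def NewtonIter (f : ℝ → ℝ → ℝ) (ε : ℝ) (x : ℕ → ℝ) (n : ℕ) (u0 : ℝ → ℝ)
    (Y : ℕ → ℕ → ℝ) : Prop :=
  (∀ i ≤ n, Y 0 i = u0 (x i)) ∧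
  ∀ m : ℕ,
    (∀ i : ℕ, 1 ≤ i → i < n →
      -ε ^ 2 * ddiff x (Y (m+1)) i + pderiv1 f (x i) (Y m i) * Y (m+1) i
        = -f (x i) (Y m i) + pderiv1 f (x i) (Y m i) * Y m i) ∧
    Y (m+1) 0 = 0 ∧ Y (m+1) n = 0

/-! ### Elementary calculus lemmas -/

/-- layer function -/
def lay (δ ε x : ℝ) : ℝ := Real.exp (-δ * x / ε) + Real.exp (-δ * (1 - x) / ε)

/-- weak maximum principle -/
lemma max_principle (z z1 z2 : ℝ → ℝ) (hz : ContinuousOn z (Icc 0 1))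
    (h1 : ∀ x ∈ Ioo (0:ℝ) 1, HasDerivAt z (z1 x) x)
    (h2 : ∀ x ∈ Ioo (0:ℝ) 1, HasDerivAt z1 (z2 x) x)
    (hpos : ∀ x ∈ Ioo (0:ℝ) 1, 0 < z x → 0 < z2 x)
    (h0 : z 0 ≤ 0) (hone : z 1 ≤ 0) : ∀ x ∈ Icc (0:ℝ) 1, z x ≤ 0 := by
  obtain ⟨c, hc, hmax⟩ := isCompact_Icc.exists_isMaxOn (⟨0, by simp⟩ : (Icc (0:ℝ) 1).Nonempty) hz
  intro x hx
  by_contra hneg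
  push Not at hneg
  have hzc : 0 < z c := lt_of_lt_of_le hneg (hmax hx)
  have hcI : c ∈ Ioo (0:ℝ) 1 := by
    refine ⟨lt_of_le_of_ne hc.1 ?_, lt_of_le_of_ne hc.2 ?_⟩
    · rintro rfl; linarith
    · rintro rfl; linarith
  have hnh : Ioo (0:ℝ) 1 ∈ nhds c := isOpen_Ioo.mem_nhds hcI
  have hlm : IsLocalMax z c := by
    filter_upwards [hnh] with y hy using hmax (Ioo_subset_Icc_self hy)
  have hz1 : z1 c = 0 := hlm.hasDerivAt_eq_zero (h1 c hcI)
  have hd : deriv z =ᶠ[nhds c] z1 := by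
    filter_upwards [hnh] with y hy using (h1 y hy).deriv
  have hdd : deriv (deriv z) c = z2 c := by
    rw [hd.deriv_eq]; exact (h2 c hcI).deriv
  have hlmin : IsLocalMin z c := by
    apply isLocalMin_of_deriv_deriv_pos
    · rw [hdd]; exact hpos c hcI hzc
    · rw [(h1 c hcI).deriv, hz1]
    · exact (h1 c hcI).continuousAt
  have hconst : z =ᶠ[nhds c] fun _ => z c := by
    filter_upwards [hlm, hlmin] with y ha hb using le_antisymm ha hb
  have hd0 : deriv z =ᶠ[nhds c] fun _ => 0 := by
    have := hconst.deriv
    simpa using this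
  have : deriv (deriv z) c = 0 := by rw [hd0.deriv_eq]; simp
  have := hpos c hcI hzc
  linarith

/-- monotone integration step -/
lemma int_step (ψ ψ' : ℝ → ℝ) (h K : ℝ) (k : ℕ) 
    (hc : ContinuousOn ψ (Icc 0 h)) (hd : ∀ s ∈ Ioo (0:ℝ) h, HasDerivAt ψ (ψ' s) s)
    (hb : ∀ s ∈ Ioo (0:ℝ) h, |ψ' s| ≤ K * s ^ k) (h0 : ψ 0 = 0) :
    ∀ s ∈ Icc (0:ℝ) h, |ψ s| ≤ K / (k + 1) * s ^ (k + 1) := by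
  have hk : (0:ℝ) < k + 1 := by positivity
  have hP : ∀ s : ℝ, HasDerivAt (fun s : ℝ => K / (k + 1) * s ^ (k + 1)) (K * s ^ k) s := by
    intro s
    have := (hasDerivAt_pow (k + 1) s).const_mul (K / (k + 1))
    refine this.congr_deriv ?_
    have : (k:ℝ) + 1 ≠ 0 := hk.ne'
    push_cast
    field_simp
  have hPc : Continuous (fun s : ℝ => K / (k + 1) * s ^ (k + 1)) := by fun_prop
  have key : ∀ σ : ℝ, (σ = 1 ∨ σ = -1) → ∀ s ∈ Icc (0:ℝ) h, σ * ψ s ≤ K / (k + 1) * s ^ (k + 1) := by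
    intro σ hσ s hs
    have hm : MonotoneOn (fun s => K / (k + 1) * s ^ (k + 1) - σ * ψ s) (Icc 0 h) := by
      apply monotoneOn_of_hasDerivWithinAt_nonneg (convex_Icc _ _)
        (f' := fun s => K * s ^ k - σ * ψ' s)
      · exact hPc.continuousOn.sub (hc.const_smul σ)
      · intro x hx
        rw [interior_Icc] at hx
        exact ((hP x).sub ((hd x hx).const_mul σ)).hasDerivWithinAt
      · intro x hx
        rw [interior_Icc] at hx
        have := abs_le.1 (hb x hx)
        rcases hσ with rfl | rfl <;> linarith
    have := hm (left_mem_Icc.2 (hs.1.trans hs.2)) hs hs.1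
    simp [h0] at this
    linarith
  intro s hs
  rw [abs_le]
  have a1 := key 1 (Or.inl rfl) s hs
  have a2 := key (-1) (Or.inr rfl) s hs
  constructor <;> linarith

lemma taylor2 (ψ ψ1 ψ2 : ℝ → ℝ) (h K : ℝ) (hh : 0 ≤ h)
    (hc : ContinuousOn ψ (Icc 0 h)) (hc1 : ContinuousOn ψ1 (Icc 0 h))
    (hd : ∀ s ∈ Ioo (0:ℝ) h, HasDerivAt ψ (ψ1 s) s)
    (hd1 : ∀ s ∈ Ioo (0:ℝ) h, HasDerivAt ψ1 (ψ2 s) s)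
    (hb : ∀ s ∈ Ioo (0:ℝ) h, |ψ2 s| ≤ K) :
    |ψ h - ψ 0 - ψ1 0 * h| ≤ K / 2 * h ^ 2 := by
  have s1 := int_step (fun s => ψ1 s - ψ1 0) ψ2 h K 0 (hc1.sub continuousOn_const)
    (fun s hs => (hd1 s hs).sub_const _) (by simpa using hb) (by simp)
  have s2 := int_step (fun s => ψ s - ψ 0 - ψ1 0 * s) (fun s => ψ1 s - ψ1 0) h K 1
    ((hc.sub continuousOn_const).sub (by fun_prop))
    (fun s hs => by
      have := ((hd s hs).sub_const (ψ 0)).sub ((hasDerivAt_id s).const_mul (ψ1 0))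
      exact this.congr_deriv (by simp))
    (fun s hs => by simpa using s1 s (Ioo_subset_Icc_self hs)) (by simp)
  have := s2 h ⟨hh, le_rfl⟩
  norm_num at this ⊢
  exact this

lemma taylor4 (ψ ψ1 ψ2 ψ3 ψ4 : ℝ → ℝ) (h K : ℝ) (hh : 0 ≤ h)
    (hc : ContinuousOn ψ (Icc 0 h)) (hc1 : ContinuousOn ψ1 (Icc 0 h))
    (hc2 : ContinuousOn ψ2 (Icc 0 h)) (hc3 : ContinuousOn ψ3 (Icc 0 h))
    (hd : ∀ s ∈ Ioo (0:ℝ) h, HasDerivAt ψ (ψ1 s) s)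
    (hd1 : ∀ s ∈ Ioo (0:ℝ) h, HasDerivAt ψ1 (ψ2 s) s)
    (hd2 : ∀ s ∈ Ioo (0:ℝ) h, HasDerivAt ψ2 (ψ3 s) s)
    (hd3 : ∀ s ∈ Ioo (0:ℝ) h, HasDerivAt ψ3 (ψ4 s) s)
    (hb : ∀ s ∈ Ioo (0:ℝ) h, |ψ4 s| ≤ K) :
    |ψ h - ψ 0 - ψ1 0 * h - ψ2 0 / 2 * h ^ 2 - ψ3 0 / 6 * h ^ 3| ≤ K / 24 * h ^ 4 := by
  have s1 := int_step (fun s => ψ3 s - ψ3 0) ψ4 h K 0 (hc3.sub continuousOn_const)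
    (fun s hs => (hd3 s hs).sub_const _) (by simpa using hb) (by simp)
  have s2 := int_step (fun s => ψ2 s - ψ2 0 - ψ3 0 * s) (fun s => ψ3 s - ψ3 0) h K 1
    ((hc2.sub continuousOn_const).sub (by fun_prop))
    (fun s hs => by
      have := ((hd2 s hs).sub_const (ψ2 0)).sub ((hasDerivAt_id s).const_mul (ψ3 0))
      exact this.congr_deriv (by simp))
    (fun s hs => by simpa using s1 s (Ioo_subset_Icc_self hs)) (by simp)
  have s3 := int_step (fun s => ψ1 s - ψ1 0 - ψ2 0 * s - ψ3 0 / 2 * s ^ 2)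
    (fun s => ψ2 s - ψ2 0 - ψ3 0 * s) h (K / 2) 2
    (((hc1.sub continuousOn_const).sub (by fun_prop)).sub (by fun_prop))
    (fun s hs => by
      have := (((hd1 s hs).sub_const (ψ1 0)).sub ((hasDerivAt_id s).const_mul (ψ2 0))).sub
        ((hasDerivAt_pow 2 s).const_mul (ψ3 0 / 2))
      exact this.congr_deriv (by norm_num; ring))
    (fun s hs => by
      have := s2 s (Ioo_subset_Icc_self hs)
      norm_num at this ⊢
      exact this) (by simp)
  have s4 := int_step (fun s => ψ s - ψ 0 - ψ1 0 * s - ψ2 0 / 2 * s ^ 2 - ψ3 0 / 6 * s ^ 3)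
    (fun s => ψ1 s - ψ1 0 - ψ2 0 * s - ψ3 0 / 2 * s ^ 2) h (K / 6) 3
    ((((hc.sub continuousOn_const).sub (by fun_prop)).sub (by fun_prop)).sub (by fun_prop))
    (fun s hs => by
      have := ((((hd s hs).sub_const (ψ 0)).sub ((hasDerivAt_id s).const_mul (ψ1 0))).sub
        ((hasDerivAt_pow 2 s).const_mul (ψ2 0 / 2))).sub
        ((hasDerivAt_pow 3 s).const_mul (ψ3 0 / 6))
      exact this.congr_deriv (by norm_num; ring))
    (fun s hs => by
      have := s3 s (Ioo_subset_Icc_self hs)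
      norm_num at this ⊢
      convert this using 1
      ring) (by simp)
  have := s4 h ⟨hh, le_rfl⟩
  norm_num at this ⊢
  convert this using 1
  ring

/-- interpolation inequality for the first derivative -/
lemma interp_deriv (φ φ1 φ2 : ℝ → ℝ) (p l P Q : ℝ) (hl : 0 < l) 
    (hc : ContinuousOn φ (Icc p (p + l))) (hc1 : ContinuousOn φ1 (Icc p (p + l)))
    (hd : ∀ s ∈ Ioo p (p + l), HasDerivAt φ (φ1 s) s)
    (hd1 : ∀ s ∈ Ioo p (p + l), HasDerivAt φ1 (φ2 s) s)
    (hP : ∀ s ∈ Icc p (p + l), |φ s| ≤ P) (hQ : ∀ s ∈ Ioo p (p + l), |φ2 s| ≤ Q) :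
    ∀ x ∈ Icc p (p + l), |φ1 x| ≤ 2 * P / l + l * Q := by
  intro x hx
  obtain ⟨ξ, hξ, hξe⟩ := exists_hasDerivAt_eq_slope φ φ1 (by linarith : p < p + l) hc hd
  have hb1 : |φ1 ξ| ≤ 2 * P / l := by
    rw [hξe, abs_div]
    have e1 : |p + l - p| = l := by rw [add_sub_cancel_left, abs_of_pos hl]
    rw [e1]
    gcongr
    have := hP (p + l) ⟨by linarith, le_rfl⟩
    have := hP p ⟨le_rfl, by linarith⟩
    have := abs_sub (φ (p + l)) (φ p)
    linarith
  have hQ0 : 0 ≤ Q := (abs_nonneg _).trans (hQ ξ hξ)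
  have hlip : ∀ y z, y ∈ Icc p (p + l) → z ∈ Icc p (p + l) → y < z → |φ1 z - φ1 y| ≤ l * Q := by
    intro y z hy hz hyz
    have hsub : Ioo y z ⊆ Ioo p (p + l) := Ioo_subset_Ioo hy.1 hz.2
    obtain ⟨η, hη, hηe⟩ := exists_hasDerivAt_eq_slope φ1 φ2 hyz
      (hc1.mono (Icc_subset_Icc hy.1 hz.2)) (fun s hs => hd1 s (hsub hs))
    have hne : z - y ≠ 0 := by linarith
    have e : φ1 z - φ1 y = φ2 η * (z - y) := by rw [hηe]; field_simp
    rw [e, abs_mul, abs_of_pos (by linarith : 0 < z - y), mul_comm]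
    have := hQ η (hsub hη)
    have : z - y ≤ l := by linarith [hy.1, hz.2]
    gcongr
  have h3 : |φ1 x - φ1 ξ| ≤ l * Q := by
    rcases lt_trichotomy x ξ with h | h | h
    · rw [abs_sub_comm]; exact hlip _ _ hx (Ioo_subset_Icc_self hξ) h
    · rw [h]; simp; positivity
    · exact hlip _ _ (Ioo_subset_Icc_self hξ) hx h
  have := abs_sub_abs_le_abs_sub (φ1 x) (φ1 ξ)
  linarith

/-- chain of derivatives on the unit interval -/
structure Chain (v v1 g g1 g2 : ℝ → ℝ) : Prop where
  c0 : ContinuousOn v (Icc 0 1)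
  c1 : ContinuousOn v1 (Icc 0 1)
  c2 : ContinuousOn g (Icc 0 1)
  c3 : ContinuousOn g1 (Icc 0 1)
  d0 : ∀ s ∈ Ioo (0:ℝ) 1, HasDerivAt v (v1 s) s
  d1 : ∀ s ∈ Ioo (0:ℝ) 1, HasDerivAt v1 (g s) s
  d2 : ∀ s ∈ Ioo (0:ℝ) 1, HasDerivAt g (g1 s) s
  d3 : ∀ s ∈ Ioo (0:ℝ) 1, HasDerivAt g1 (g2 s) s

lemma hasDerivAt_shift_right (φ : ℝ → ℝ) (d x s : ℝ) (h : HasDerivAt φ d (x + s)) :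
    HasDerivAt (fun s => φ (x + s)) d s := by
  have := h.comp s ((hasDerivAt_id s).const_add x)
  exact this.congr_deriv (by simp)

lemma hasDerivAt_shift_left (φ : ℝ → ℝ) (d x s : ℝ) (h : HasDerivAt φ d (x - s)) :
    HasDerivAt (fun s => φ (x - s)) (-d) s := by
  have := h.comp s ((hasDerivAt_id s).const_sub x)
  exact this.congr_deriv (by simp)

lemma trunc_right (v v1 g g1 g2 : ℝ → ℝ) (H : Chain v v1 g g1 g2) (x k G0 G2 : ℝ)
    (hk : 0 < k) (hx : 0 < x) (hxk : x + k ≤ 1) 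
    (h0 : ∀ s ∈ Ioo x (x + k), |g s| ≤ G0) (h2 : ∀ s ∈ Ioo x (x + k), |g2 s| ≤ G2) :
    |v (x + k) - v x - v1 x * k| ≤ G0 / 2 * k ^ 2 ∧
    |v (x + k) - v x - v1 x * k - g x / 2 * k ^ 2 - g1 x / 6 * k ^ 3| ≤ G2 / 24 * k ^ 4 := by
  have mI : ∀ s ∈ Ioo (0:ℝ) k, x + s ∈ Ioo (0:ℝ) 1 := fun s hs => ⟨by linarith [hs.1], by linarith [hs.2]⟩
  have mJ : ∀ s ∈ Ioo (0:ℝ) k, x + s ∈ Ioo x (x + k) := fun s hs => ⟨by linarith [hs.1], by linarith [hs.2]⟩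
  have cc : ∀ φ : ℝ → ℝ, ContinuousOn φ (Icc 0 1) → ContinuousOn (fun s => φ (x + s)) (Icc 0 k) := by
    intro φ hφ
    refine hφ.comp (by fun_prop) ?_
    intro s hs
    exact ⟨by linarith [hs.1], by linarith [hs.2]⟩
  constructor
  · have := taylor2 (fun s => v (x + s)) (fun s => v1 (x + s)) (fun s => g (x + s)) k G0 hk.le
      (cc _ H.c0) (cc _ H.c1)
      (fun s hs => hasDerivAt_shift_right _ _ _ _ (H.d0 _ (mI s hs)))
      (fun s hs => hasDerivAt_shift_right _ _ _ _ (H.d1 _ (mI s hs)))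
      (fun s hs => h0 _ (mJ s hs))
    simpa using this
  · have := taylor4 (fun s => v (x + s)) (fun s => v1 (x + s)) (fun s => g (x + s))
      (fun s => g1 (x + s)) (fun s => g2 (x + s)) k G2 hk.le
      (cc _ H.c0) (cc _ H.c1) (cc _ H.c2) (cc _ H.c3)
      (fun s hs => hasDerivAt_shift_right _ _ _ _ (H.d0 _ (mI s hs)))
      (fun s hs => hasDerivAt_shift_right _ _ _ _ (H.d1 _ (mI s hs)))
      (fun s hs => hasDerivAt_shift_right _ _ _ _ (H.d2 _ (mI s hs)))
      (fun s hs => hasDerivAt_shift_right _ _ _ _ (H.d3 _ (mI s hs)))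
      (fun s hs => h2 _ (mJ s hs))
    simpa using this

lemma Chain.reflect {v v1 g g1 g2 : ℝ → ℝ} (H : Chain v v1 g g1 g2) :
    Chain (fun s => v (1 - s)) (fun s => -v1 (1 - s)) (fun s => g (1 - s)) (fun s => -g1 (1 - s))
      (fun s => g2 (1 - s)) := by
  have mI : ∀ s ∈ Ioo (0:ℝ) 1, 1 - s ∈ Ioo (0:ℝ) 1 := fun s hs => ⟨by linarith [hs.2], by linarith [hs.1]⟩
  have cc : ∀ φ : ℝ → ℝ, ContinuousOn φ (Icc 0 1) → ContinuousOn (fun s => φ (1 - s)) (Icc 0 1) := by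
    intro φ hφ
    refine hφ.comp (by fun_prop) ?_
    intro s hs
    exact ⟨by linarith [hs.2], by linarith [hs.1]⟩
  refine ⟨cc _ H.c0, (cc _ H.c1).neg, cc _ H.c2, (cc _ H.c3).neg, ?_, ?_, ?_, ?_⟩
  · intro s hs
    exact hasDerivAt_shift_left _ _ _ _ (H.d0 _ (mI s hs))
  · intro s hs
    exact (hasDerivAt_shift_left _ _ _ _ (H.d1 _ (mI s hs))).neg.congr_deriv (by simp)
  · intro s hs
    exact hasDerivAt_shift_left _ _ _ _ (H.d2 _ (mI s hs))
  · intro s hs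
    exact (hasDerivAt_shift_left _ _ _ _ (H.d3 _ (mI s hs))).neg.congr_deriv (by simp)

/-- local truncation error -/
lemma trunc (v v1 g g1 g2 : ℝ → ℝ) (H : Chain v v1 g g1 g2) (x h k G0 G2 : ℝ)
    (hh : 0 < h) (hk : 0 < k) (hxh : 0 ≤ x - h) (hxk : x + k ≤ 1)
    (h0 : ∀ s ∈ Ioo (x - h) (x + k), |g s| ≤ G0) (h2 : ∀ s ∈ Ioo (x - h) (x + k), |g2 s| ≤ G2) :
    |2 / (h + k) * ((v (x + k) - v x) / k - (v x - v (x - h)) / h) - g x| ≤ 2 * G0 ∧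
    |2 / (h + k) * ((v (x + k) - v x) / k - (v x - v (x - h)) / h) - g x|
      ≤ |k - h| * |g1 x| + (h ^ 2 + k ^ 2) * G2 := by
  have hxx : x ∈ Ioo (x - h) (x + k) := ⟨by linarith, by linarith⟩
  obtain ⟨r2, r4⟩ := trunc_right v v1 g g1 g2 H x k G0 G2 hk (by linarith) hxk
    (fun s hs => h0 s ⟨by linarith [hs.1], hs.2⟩) (fun s hs => h2 s ⟨by linarith [hs.1], hs.2⟩)
  obtain ⟨l2, l4⟩ := trunc_right _ _ _ _ _ H.reflect (1 - x) h G0 G2 hh (by linarith) (by linarith)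
    (fun s hs => h0 _ ⟨by linarith [hs.2], by linarith [hs.1]⟩)
    (fun s hs => h2 _ ⟨by linarith [hs.2], by linarith [hs.1]⟩)
  have e1 : 1 - (1 - x + h) = x - h := by ring
  have e2 : 1 - (1 - x) = x := by ring
  simp only [e1, e2] at l2 l4
  have hG0 : |g x| ≤ G0 := h0 x hxx
  have hG2 : 0 ≤ G2 := (abs_nonneg _).trans (h2 x hxx)
  have hhk : 0 < h + k := by linarith
  constructor
  · set R := v (x + k) - v x - v1 x * k with hR
    set S := v (x - h) - v x - -v1 x * h with hS
    have e : 2 / (h + k) * ((v (x + k) - v x) / k - (v x - v (x - h)) / h)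
        = 2 / (h + k) * (R / k + S / h) := by
      rw [hR, hS]; field_simp; ring
    have b1 : |R / k| ≤ G0 / 2 * k := by
      rw [abs_div, abs_of_pos hk, div_le_iff₀ hk]; linarith
    have b2 : |S / h| ≤ G0 / 2 * h := by
      rw [abs_div, abs_of_pos hh, div_le_iff₀ hh]; linarith
    have b3 : |2 / (h + k) * (R / k + S / h)| ≤ G0 := by
      rw [abs_mul, abs_of_pos (by positivity : 0 < 2 / (h + k)), div_mul_eq_mul_div, div_le_iff₀ hhk]
      have := abs_add_le (R / k) (S / h)
      nlinarith
    rw [e]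
    have := abs_sub (2 / (h + k) * (R / k + S / h)) (g x)
    linarith
  · set R := v (x + k) - v x - v1 x * k - g x / 2 * k ^ 2 - g1 x / 6 * k ^ 3 with hR
    set S := v (x - h) - v x - -v1 x * h - g x / 2 * h ^ 2 - -g1 x / 6 * h ^ 3 with hS
    have e : 2 / (h + k) * ((v (x + k) - v x) / k - (v x - v (x - h)) / h) - g x
        = (k - h) * g1 x / 3 + 2 / (h + k) * (R / k + S / h) := by
      rw [hR, hS]; field_simp; ring
    have b1 : |R / k| ≤ G2 / 24 * k ^ 3 := by
      rw [abs_div, abs_of_pos hk, div_le_iff₀ hk]; linarith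
    have b2 : |S / h| ≤ G2 / 24 * h ^ 3 := by
      rw [abs_div, abs_of_pos hh, div_le_iff₀ hh]; linarith
    have b3 : |2 / (h + k) * (R / k + S / h)| ≤ (h ^ 2 + k ^ 2) * G2 := by
      rw [abs_mul, abs_of_pos (by positivity : 0 < 2 / (h + k)), div_mul_eq_mul_div, div_le_iff₀ hhk]
      have := abs_add_le (R / k) (S / h)
      have : 0 ≤ G2 * (h ^ 3 + k ^ 3) := by positivity
      have : 0 ≤ G2 * (h * k * (h + k)) := by positivity
      nlinarith
    rw [e]
    have := abs_add_le ((k - h) * g1 x / 3) (2 / (h + k) * (R / k + S / h))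
    have e3 : |(k - h) * g1 x / 3| ≤ |k - h| * |g1 x| := by
      rw [abs_div, abs_mul]
      have : 0 ≤ |k - h| * |g1 x| := by positivity
      rw [abs_of_pos (by norm_num : (0:ℝ) < 3)]
      linarith
    linarith

/-- the strip `[0,1] × ℝ` -/
def strip : Set (ℝ × ℝ) := (Icc (0:ℝ) 1) ×ˢ (univ : Set ℝ)

lemma strip_unique : UniqueDiffOn ℝ strip :=
  (uniqueDiffOn_Icc (by norm_num)).prod uniqueDiffOn_univ

/-- directional derivative within the strip -/
def dirD (F : ℝ × ℝ → ℝ) (e : ℝ × ℝ) (p : ℝ × ℝ) : ℝ := fderivWithin ℝ F strip p e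

lemma dirD_contDiff (F : ℝ × ℝ → ℝ) (e : ℝ × ℝ) (m k : ℕ) (hF : ContDiffOn ℝ m F strip)
    (hk : k + 1 ≤ m) : ContDiffOn ℝ k (dirD F e) strip := by
  have : ContDiffOn ℝ k (fderivWithin ℝ F strip) strip :=
    hF.fderivWithin strip_unique (by exact_mod_cast hk)
  exact this.clm_apply contDiffOn_const

lemma chain_rule (F : ℝ × ℝ → ℝ) (hF : ContDiffOn ℝ 1 F strip) (v : ℝ → ℝ) (v' x : ℝ)
    (hx : x ∈ Ioo (0:ℝ) 1) (hv : HasDerivAt v v' x) :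
    HasDerivAt (fun s => F (s, v s)) (dirD F (1, 0) (x, v x) + dirD F (0, 1) (x, v x) * v') x := by
  have hmem : (x, v x) ∈ strip := ⟨Ioo_subset_Icc_self hx, mem_univ _⟩
  have hnh : strip ∈ nhds (x, v x) := prod_mem_nhds (Icc_mem_nhds hx.1 hx.2) Filter.univ_mem
  have h1 : HasFDerivAt F (fderivWithin ℝ F strip (x, v x)) (x, v x) :=
    ((hF.differentiableOn (by norm_num)) _ hmem).hasFDerivWithinAt.hasFDerivAt hnh
  have h2 : HasDerivAt (fun s => (s, v s)) ((1:ℝ), v') x := (hasDerivAt_id x).prodMk hv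
  have := h1.comp_hasDerivAt x h2
  refine this.congr_deriv ?_
  unfold dirD
  have : ((1:ℝ), v') = (1, 0) + v' • ((0:ℝ), (1:ℝ)) := by simp
  rw [this, map_add, map_smul, smul_eq_mul, mul_comm]

lemma pderiv1_eq (f : ℝ → ℝ → ℝ) (hf : ContDiffOn ℝ 1 (fun p : ℝ × ℝ => f p.1 p.2) strip)
    (x y : ℝ) (hx : x ∈ Icc (0:ℝ) 1) :
    dirD (fun p : ℝ × ℝ => f p.1 p.2) (0, 1) (x, y) = pderiv1 f x y := by
  have hmem : (x, y) ∈ strip := ⟨hx, mem_univ _⟩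
  have h1 := ((hf.differentiableOn (by norm_num)) _ hmem).hasFDerivWithinAt
  have h2 : HasDerivAt (fun s : ℝ => (x, s)) ((0:ℝ), (1:ℝ)) y :=
    (hasDerivAt_const y x).prodMk (hasDerivAt_id y)
  have h3 := h1.comp_hasDerivAt (f := fun s : ℝ => (x, s)) y h2 (Filter.Eventually.of_forall fun s => ⟨hx, mem_univ _⟩)
  exact h3.deriv.symm

lemma f_mono (f : ℝ → ℝ → ℝ) (c₀ : ℝ) (hc₀ : 0 < c₀) (hfu : LowerF f c₀) (x : ℝ)
    (hx : x ∈ Icc (0:ℝ) 1) (y z : ℝ) (hyz : y ≤ z) : c₀ ^ 2 * (z - y) ≤ f x z - f x y := by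
  have hd : Differentiable ℝ (fun z => f x z) := by
    intro w
    by_contra hcon
    have h1 := hfu x hx w
    unfold pderiv1 at h1
    rw [deriv_zero_of_not_differentiableAt hcon] at h1
    have : 0 < c₀ ^ 2 := by positivity
    linarith
  exact mul_sub_le_image_sub_of_le_deriv hd (fun w => hfu x hx w) hyz

lemma bdd_on (F : ℝ × ℝ → ℝ) (hF : ContinuousOn F strip) (L : ℝ) :
    ∃ M : ℝ, 0 < M ∧ ∀ x ∈ Icc (0:ℝ) 1, ∀ y, |y| ≤ L → |F (x, y)| ≤ M := by
  have hK : IsCompact ((Icc (0:ℝ) 1) ×ˢ (Icc (-L) L)) := isCompact_Icc.prod isCompact_Icc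
  obtain ⟨M, hM⟩ := hK.exists_bound_of_continuousOn (hF.mono (prod_mono_right (subset_univ _)))
  refine ⟨max M 1, by positivity, fun x hx y hy => ?_⟩
  exact (hM (x, y) ⟨hx, abs_le.1 hy⟩).trans (le_max_left _ _)

lemma sol_bound (f : ℝ → ℝ → ℝ) (c₀ : ℝ) (hc₀ : 0 < c₀) (hfu : LowerF f c₀) (L ε : ℝ) (hε : 0 < ε)
    (hL : ∀ x ∈ Icc (0:ℝ) 1, |f x 0| ≤ c₀ ^ 2 * L) (u u1 : ℝ → ℝ)
    (hu : ContinuousOn u (Icc 0 1)) (h1 : ∀ x ∈ Ioo (0:ℝ) 1, HasDerivAt u (u1 x) x)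
    (h2 : ∀ x ∈ Ioo (0:ℝ) 1, HasDerivAt u1 (f x (u x) / ε ^ 2) x) (u0 : u 0 = 0) (u11 : u 1 = 0) :
    ∀ x ∈ Icc (0:ℝ) 1, |u x| ≤ L := by
  have hL0 : 0 ≤ L := by
    have := (abs_nonneg _).trans (hL 0 (by simp))
    exact nonneg_of_mul_nonneg_right this (by positivity)
  intro x hx
  rw [abs_le]
  constructor
  · have := max_principle (fun s => -L - u s) (fun s => -u1 s) (fun s => -(f s (u s) / ε ^ 2))
      (continuousOn_const.sub hu) (fun s hs => (h1 s hs).const_sub _) (fun s hs => (h2 s hs).neg)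
      (fun s hs hp => by
        have hs' := Ioo_subset_Icc_self hs
        have a1 := f_mono f c₀ hc₀ hfu s hs' (u s) 0 (by linarith)
        have a2 := abs_le.1 (hL s hs')
        have a3 : c₀ ^ 2 * (-L - u s) > 0 := by positivity
        have : 0 < -f s (u s) := by linarith
        rw [← neg_div]; positivity) (by simp [u0]; linarith) (by simp [u11]; linarith) x hx
    linarith
  · have := max_principle (fun s => u s - L) u1 (fun s => (f s (u s) / ε ^ 2))
      (hu.sub continuousOn_const) (fun s hs => (h1 s hs).sub_const _) (fun s hs => (h2 s hs))
      (fun s hs hp => by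
        have hs' := Ioo_subset_Icc_self hs
        have a1 := f_mono f c₀ hc₀ hfu s hs' 0 (u s) (by linarith)
        have a2 := abs_le.1 (hL s hs')
        have a3 : c₀ ^ 2 * (u s - L) > 0 := by positivity
        have : 0 < f s (u s) := by linarith
        positivity) (by simp [u0]; linarith) (by simp [u11]; linarith) x hx
    linarith

/-- data extracted from a solution -/
lemma extract (f : ℝ → ℝ → ℝ) (c₀ : ℝ) (hc₀ : 0 < c₀) (hf : SmoothF f) (hfu : LowerF f c₀) :
    ∃ L M : ℝ, 0 < L ∧ 0 < M ∧ ∀ ε ∈ Ioc (0:ℝ) 1, ∀ u : ℝ → ℝ, IsSolution f ε u →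
      ∃ u1 g1 g2 a b : ℝ → ℝ, Chain (fun s => ε ^ 2 * u s) (fun s => ε ^ 2 * u1 s)
        (fun s => f s (u s)) g1 g2 ∧
      (∀ x ∈ Icc (0:ℝ) 1, |u x| ≤ L ∧ |f x (u x)| ≤ M ∧ |a x| ≤ M ∧ |b x| ≤ M ∧ c₀ ^ 2 ≤ b x ∧
        g1 x = a x + b x * u1 x ∧
        |g2 x - b x * (f x (u x) / ε ^ 2)| ≤ M * (1 + u1 x ^ 2)) := by
  set F : ℝ × ℝ → ℝ := fun p => f p.1 p.2 with hFdef
  have hF : ContDiffOn ℝ 4 F strip := hf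
  have hF1 : ContDiffOn ℝ 1 F strip := hF.of_le (by norm_num)
  set A := dirD F (1, 0) with hA
  set B := dirD F (0, 1) with hB
  have hA3 : ContDiffOn ℝ (3:ℕ) A strip := dirD_contDiff F _ 4 3 hF (by norm_num)
  have hB3 : ContDiffOn ℝ (3:ℕ) B strip := dirD_contDiff F _ 4 3 hF (by norm_num)
  have hA1 : ContDiffOn ℝ 1 A strip := hA3.of_le (by norm_num)
  have hB1 : ContDiffOn ℝ 1 B strip := hB3.of_le (by norm_num)
  have hAx : ContinuousOn (dirD A (1, 0)) strip := (dirD_contDiff A _ 3 2 hA3 (by norm_num)).continuousOn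
  have hAy : ContinuousOn (dirD A (0, 1)) strip := (dirD_contDiff A _ 3 2 hA3 (by norm_num)).continuousOn
  have hBx : ContinuousOn (dirD B (1, 0)) strip := (dirD_contDiff B _ 3 2 hB3 (by norm_num)).continuousOn
  have hBy : ContinuousOn (dirD B (0, 1)) strip := (dirD_contDiff B _ 3 2 hB3 (by norm_num)).continuousOn
  obtain ⟨M0, hM0, hb0⟩ := bdd_on F hF.continuousOn 0
  obtain ⟨L, hLdef⟩ : ∃ L, L = M0 / c₀ ^ 2 := ⟨_, rfl⟩
  have hLpos : 0 < L := by rw [hLdef]; positivity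
  have hL : ∀ x ∈ Icc (0:ℝ) 1, |f x 0| ≤ c₀ ^ 2 * L := by
    intro x hx
    rw [hLdef, mul_div_cancel₀ _ (by positivity)]
    exact hb0 x hx 0 (by simp)
  obtain ⟨M1, hM1, hb1⟩ := bdd_on F hF.continuousOn L
  obtain ⟨M2, hM2, hb2⟩ := bdd_on A hA1.continuousOn L
  obtain ⟨M3, hM3, hb3⟩ := bdd_on B hB1.continuousOn L
  obtain ⟨M4, hM4, hb4⟩ := bdd_on _ hAx L
  obtain ⟨M5, hM5, hb5⟩ := bdd_on _ hAy L
  obtain ⟨M6, hM6, hb6⟩ := bdd_on _ hBx L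
  obtain ⟨M7, hM7, hb7⟩ := bdd_on _ hBy L
  refine ⟨L, M1 + M2 + M3 + M4 + M5 + M6 + M7, hLpos, by positivity, ?_⟩
  intro ε hε u hu
  obtain ⟨huC, hueq, hu0, hu1⟩ := hu
  have hε0 : 0 < ε := hε.1
  have hI : UniqueDiffOn ℝ (Icc (0:ℝ) 1) := uniqueDiffOn_Icc (by norm_num)
  set u1 := derivWithin u (Icc (0:ℝ) 1) with hu1def
  have hu1C : ContDiffOn ℝ (3:ℕ) u1 (Icc 0 1) := huC.derivWithin hI (by norm_num)
  have hd0 : ∀ x ∈ Ioo (0:ℝ) 1, HasDerivAt u (u1 x) x := by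
    intro x hx
    exact ((huC.differentiableOn (by norm_num)) x (Ioo_subset_Icc_self hx)).hasDerivWithinAt.hasDerivAt
      (Icc_mem_nhds hx.1 hx.2)
  have hd1 : ∀ x ∈ Ioo (0:ℝ) 1, HasDerivAt u1 (f x (u x) / ε ^ 2) x := by
    intro x hx
    have h := ((hu1C.differentiableOn (by norm_num)) x (Ioo_subset_Icc_self hx)).hasDerivWithinAt.hasDerivAt
      (Icc_mem_nhds hx.1 hx.2)
    refine h.congr_deriv ?_
    have e := hueq x hx
    rw [iteratedDerivWithin_succ, iteratedDerivWithin_one] at e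
    rw [eq_div_iff (by positivity)]
    linarith
  have hbd := sol_bound f c₀ hc₀ hfu L ε hε0 hL u u1 huC.continuousOn hd0 hd1 hu0 hu1
  have hcurve : ContinuousOn (fun s => (s, u s)) (Icc (0:ℝ) 1) := continuousOn_id.prodMk huC.continuousOn
  have hmaps : MapsTo (fun s => (s, u s)) (Icc (0:ℝ) 1) strip := fun s hs => ⟨hs, mem_univ _⟩
  refine ⟨u1, fun x => A (x, u x) + B (x, u x) * u1 x,
    fun x => dirD A (1, 0) (x, u x) + dirD A (0, 1) (x, u x) * u1 x +
      ((dirD B (1, 0) (x, u x) + dirD B (0, 1) (x, u x) * u1 x) * u1 x +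
        B (x, u x) * (f x (u x) / ε ^ 2)),
    fun x => A (x, u x), fun x => B (x, u x), ?_, ?_⟩
  · refine ⟨continuousOn_const.mul huC.continuousOn, continuousOn_const.mul hu1C.continuousOn, 
      hF.continuousOn.comp hcurve hmaps,
      (hA1.continuousOn.comp hcurve hmaps).add ((hB1.continuousOn.comp hcurve hmaps).mul hu1C.continuousOn),
      fun s hs => (hd0 s hs).const_mul _, ?_, ?_, ?_⟩
    · intro s hs
      refine ((hd1 s hs).const_mul (ε ^ 2)).congr_deriv ?_
      field_simp
    · intro s hs
      exact chain_rule F hF1 u _ s hs (hd0 s hs)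
    · intro s hs
      exact (chain_rule A hA1 u _ s hs (hd0 s hs)).add
        ((chain_rule B hB1 u _ s hs (hd0 s hs)).mul (hd1 s hs))
  · intro x hx
    have hux := hbd x hx
    have b1 : |f x (u x)| ≤ M1 := hb1 x hx _ hux
    have b2 := hb2 x hx _ hux
    have b3 := hb3 x hx _ hux
    have b4 := hb4 x hx _ hux
    have b5 := hb5 x hx _ hux
    have b6 := hb6 x hx _ hux
    have b7 := hb7 x hx _ hux
    refine ⟨hux, by linarith, by linarith, by linarith, ?_, rfl, ?_⟩
    · show c₀ ^ 2 ≤ B (x, u x)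
      rw [hB, pderiv1_eq f hF1 x (u x) hx]
      exact hfu x hx _
    · have e : dirD A (1, 0) (x, u x) + dirD A (0, 1) (x, u x) * u1 x +
          ((dirD B (1, 0) (x, u x) + dirD B (0, 1) (x, u x) * u1 x) * u1 x +
            B (x, u x) * (f x (u x) / ε ^ 2)) - B (x, u x) * (f x (u x) / ε ^ 2)
          = dirD A (1, 0) (x, u x) + dirD A (0, 1) (x, u x) * u1 x +
          (dirD B (1, 0) (x, u x) * u1 x + dirD B (0, 1) (x, u x) * u1 x ^ 2) := by ring
      show |_| ≤ _
      rw [e]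
      have t1 := abs_add_le (dirD A (1, 0) (x, u x) + dirD A (0, 1) (x, u x) * u1 x)
          (dirD B (1, 0) (x, u x) * u1 x + dirD B (0, 1) (x, u x) * u1 x ^ 2)
      have t2 := abs_add_le (dirD A (1, 0) (x, u x)) (dirD A (0, 1) (x, u x) * u1 x)
      have t3 := abs_add_le (dirD B (1, 0) (x, u x) * u1 x) (dirD B (0, 1) (x, u x) * u1 x ^ 2)
      have hu' : |u1 x| ≤ 1 + u1 x ^ 2 := by
        rw [abs_le]; constructor <;> nlinarith [sq_nonneg (u1 x - 1), sq_nonneg (u1 x + 1)]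
      have t4 : |dirD A (0, 1) (x, u x) * u1 x| ≤ M5 * (1 + u1 x ^ 2) := by
        rw [abs_mul]; gcongr
      have t5 : |dirD B (1, 0) (x, u x) * u1 x| ≤ M6 * (1 + u1 x ^ 2) := by
        rw [abs_mul]; gcongr
      have t6 : |dirD B (0, 1) (x, u x) * u1 x ^ 2| ≤ M7 * (1 + u1 x ^ 2) := by
        rw [abs_mul, abs_of_nonneg (sq_nonneg (u1 x))]
        gcongr
        linarith
      have t7 : M4 ≤ M4 * (1 + u1 x ^ 2) := by nlinarith [sq_nonneg (u1 x)]
      have t8 : 0 ≤ (M1 + M2 + M3) * (1 + u1 x ^ 2) := by positivity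
      linarith

lemma lay_pos (δ ε x : ℝ) : 0 < lay δ ε x := by unfold lay; positivity

lemma lay_le_two (δ ε x : ℝ) (hδ : 0 < δ) (hε : 0 < ε) (hx : x ∈ Icc (0:ℝ) 1) : lay δ ε x ≤ 2 := by
  unfold lay
  have h1 : Real.exp (-δ * x / ε) ≤ 1 := by
    rw [Real.exp_le_one_iff]
    apply div_nonpos_of_nonpos_of_nonneg _ hε.le
    nlinarith [hx.1]
  have h2 : Real.exp (-δ * (1 - x) / ε) ≤ 1 := by
    rw [Real.exp_le_one_iff]
    apply div_nonpos_of_nonpos_of_nonneg _ hε.le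
    nlinarith [hx.2]
  linarith

lemma lay_zero (δ ε : ℝ) : 1 ≤ lay δ ε 0 := by
  unfold lay; simp; positivity

lemma lay_one (δ ε : ℝ) : 1 ≤ lay δ ε 1 := by
  unfold lay; simp; positivity

lemma lay_deriv (δ ε x : ℝ) : HasDerivAt (lay δ ε)
    (-(δ / ε) * Real.exp (-δ * x / ε) + δ / ε * Real.exp (-δ * (1 - x) / ε)) x := by
  have e1 : HasDerivAt (fun x : ℝ => -δ * x / ε) (-δ * 1 / ε) x :=
    ((hasDerivAt_id x).const_mul (-δ)).div_const ε
  have e2 : HasDerivAt (fun x : ℝ => -δ * (1 - x) / ε) (-δ * (-1) / ε) x :=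
    (((hasDerivAt_id x).const_sub 1).const_mul (-δ)).div_const ε
  refine (e1.exp.add e2.exp).congr_deriv ?_
  ring

lemma lay_deriv2 (δ ε x : ℝ) : HasDerivAt
    (fun x => -(δ / ε) * Real.exp (-δ * x / ε) + δ / ε * Real.exp (-δ * (1 - x) / ε))
    ((δ / ε) ^ 2 * lay δ ε x) x := by
  have e1 : HasDerivAt (fun x : ℝ => -δ * x / ε) (-δ * 1 / ε) x :=
    ((hasDerivAt_id x).const_mul (-δ)).div_const ε
  have e2 : HasDerivAt (fun x : ℝ => -δ * (1 - x) / ε) (-δ * (-1) / ε) x :=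
    (((hasDerivAt_id x).const_sub 1).const_mul (-δ)).div_const ε
  refine ((e1.exp.const_mul _).add (e2.exp.const_mul _)).congr_deriv ?_
  unfold lay
  ring

lemma lay_near (δ ε x s : ℝ) (hδ : 0 < δ) (hε : 0 < ε) (h : |s - x| ≤ ε) :
    lay δ ε s ≤ Real.exp δ * lay δ ε x := by
  unfold lay
  rw [mul_add, ← Real.exp_add, ← Real.exp_add]
  have := abs_le.1 h
  gcongr
  · rw [div_le_iff₀ hε, add_mul, div_mul_cancel₀ _ hε.ne']
    nlinarith
  · rw [div_le_iff₀ hε, add_mul, div_mul_cancel₀ _ hε.ne']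
    nlinarith

lemma barrier (c₀ δ ε K P Q : ℝ) (hε : 0 < ε)
    (hK : 0 ≤ K) (hP : 0 ≤ P) (hQ : 0 ≤ Q) (w w1 w2 b : ℝ → ℝ)
    (hw : ContinuousOn w (Icc 0 1))
    (h1 : ∀ x ∈ Ioo (0:ℝ) 1, HasDerivAt w (w1 x) x)
    (h2 : ∀ x ∈ Ioo (0:ℝ) 1, HasDerivAt w1 (w2 x) x)
    (hb : ∀ x ∈ Ioo (0:ℝ) 1, c₀ ^ 2 ≤ b x)
    (hr : ∀ x ∈ Ioo (0:ℝ) 1, |ε ^ 2 * w2 x - b x * w x| <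
      K * (c₀ ^ 2 * P + (c₀ ^ 2 - δ ^ 2) * (Q * lay δ ε x)))
    (hw0 : |w 0| ≤ K * Q) (hw1 : |w 1| ≤ K * Q) :
    ∀ x ∈ Icc (0:ℝ) 1, |w x| ≤ K * (P + Q * lay δ ε x) := by
  have key : ∀ σ : ℝ, (σ = 1 ∨ σ = -1) → ∀ x ∈ Icc (0:ℝ) 1, σ * w x - K * (P + Q * lay δ ε x) ≤ 0 := by
    intro σ hσ
    have hlc : Continuous (lay δ ε) := by unfold lay; fun_prop
    have hbdry : ∀ s, |w s| ≤ K * Q → 1 ≤ lay δ ε s → σ * w s - K * (P + Q * lay δ ε s) ≤ 0 := by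
      intro s hs hl
      have a1 := abs_le.1 hs
      have a2 : K * Q ≤ K * (P + Q * lay δ ε s) := by
        gcongr
        nlinarith
      rcases hσ with rfl | rfl <;> linarith
    refine max_principle _ (fun x => σ * w1 x - K * (Q * (-(δ / ε) * Real.exp (-δ * x / ε) + δ / ε * Real.exp (-δ * (1 - x) / ε))))
      (fun x => σ * w2 x - K * (Q * ((δ / ε) ^ 2 * lay δ ε x))) ?_ ?_ ?_ ?_ ?_ ?_
    · exact (hw.const_smul σ).sub (by fun_prop)
    · intro x hx
      exact ((h1 x hx).const_mul σ).sub ((((lay_deriv δ ε x).const_mul Q).const_add P).const_mul K)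
    · intro x hx
      exact ((h2 x hx).const_mul σ).sub (((lay_deriv2 δ ε x).const_mul Q).const_mul K)
    · intro x hx hp
      have a1 := abs_lt.1 (hr x hx)
      have a2 := hb x hx
      have hl := lay_pos δ ε x
      have hΦ : 0 ≤ K * (P + Q * lay δ ε x) := by positivity
      have a3 : c₀ ^ 2 * (K * (P + Q * lay δ ε x)) ≤ b x * (σ * w x) := by
        apply mul_le_mul a2 (by linarith) hΦ (le_trans (sq_nonneg _) a2)
      have e : ε ^ 2 * (σ * w2 x - K * (Q * ((δ / ε) ^ 2 * lay δ ε x)))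
          = σ * (ε ^ 2 * w2 x) - K * (Q * (δ ^ 2 * lay δ ε x)) := by
        field_simp
      have : 0 < ε ^ 2 * (σ * w2 x - K * (Q * ((δ / ε) ^ 2 * lay δ ε x))) := by
        rw [e]
        rcases hσ with rfl | rfl <;> nlinarith
      exact pos_of_mul_pos_right this (by positivity)
    · exact hbdry 0 hw0 (lay_zero _ _)
    · exact hbdry 1 hw1 (lay_one _ _)
  intro x hx
  have a1 := key 1 (Or.inl rfl) x hx
  have a2 := key (-1) (Or.inr rfl) x hx
  rw [abs_le]
  constructor <;> linarith

set_option maxHeartbeats 1600000 in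
/-- a priori bounds on the solution -/
lemma apriori (f : ℝ → ℝ → ℝ) (c₀ : ℝ) (hc₀ : 0 < c₀) (hf : SmoothF f) (hfu : LowerF f c₀) :
    ∃ K : ℝ, 0 < K ∧ ∀ ε ∈ Ioc (0:ℝ) 1, ∀ u : ℝ → ℝ, IsSolution f ε u →
      ∃ u1 g1 g2 : ℝ → ℝ, Chain (fun s => ε ^ 2 * u s) (fun s => ε ^ 2 * u1 s)
        (fun s => f s (u s)) g1 g2 ∧
      (∀ x ∈ Icc (0:ℝ) 1, |f x (u x)| ≤ K * (ε ^ 2 + lay (c₀ / 2) ε x) ∧ 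
        |g1 x| ≤ K * (ε + lay (c₀ / 2) ε x / ε) ∧
        |g2 x| ≤ K * (1 + lay (c₀ / 2) ε x / ε ^ 2)) := by
  obtain ⟨L, M, hL, hM, hex⟩ := extract f c₀ hc₀ hf hfu
  obtain ⟨δ, hδ⟩ : ∃ δ, δ = c₀ / 2 := ⟨_, rfl⟩
  have hδ0 : 0 < δ := by rw [hδ]; positivity
  have hδc : δ ^ 2 = c₀ ^ 2 / 4 := by rw [hδ]; ring
  have hc2 : 0 < c₀ ^ 2 := by positivity
  obtain ⟨K1, hK1⟩ : ∃ K1, K1 = M / c₀ ^ 2 + 1 + 2 * L + M := ⟨_, rfl⟩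
  have hK1p : 0 < K1 := by rw [hK1]; positivity
  obtain ⟨N, hN⟩ : ∃ N, N = M * (1 + 4 * K1 ^ 2) := ⟨_, rfl⟩
  have hNp : 0 < N := by rw [hN]; positivity
  obtain ⟨K2, hK2⟩ : ∃ K2, K2 = 2 * N / c₀ ^ 2 + M := ⟨_, rfl⟩
  have hK2p : 0 < K2 := by rw [hK2]; positivity
  obtain ⟨K3, hK3⟩ : ∃ K3, K3 = N + M * K2 := ⟨_, rfl⟩
  have hK3p : 0 < K3 := by rw [hK3]; positivity
  have hexp1 : 1 ≤ Real.exp δ := Real.one_le_exp hδ0.le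
  refine ⟨(2 * K2 + K3) * Real.exp δ, by positivity, ?_⟩
  intro ε hε u hu
  obtain ⟨u1, g1, g2, A, b, H, hB⟩ := hex ε hε u hu
  have hε0 : 0 < ε := hε.1
  refine ⟨u1, g1, g2, H, ?_⟩
  rw [← hδ]
  -- continuity and derivatives of u, u1
  have cu : ContinuousOn u (Icc 0 1) := by
    refine (H.c0.const_smul (ε ^ 2)⁻¹).congr ?_
    intro s _
    simp [hε0.ne']
  have cu1 : ContinuousOn u1 (Icc 0 1) := by
    refine (H.c1.const_smul (ε ^ 2)⁻¹).congr ?_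
    intro s _
    simp [hε0.ne']
  have du : ∀ s ∈ Ioo (0:ℝ) 1, HasDerivAt u (u1 s) s := by
    intro s hs
    have := (H.d0 s hs).const_mul (ε ^ 2)⁻¹
    have e : (fun s => (ε ^ 2)⁻¹ * (ε ^ 2 * u s)) = u := by
      funext s; field_simp
    rw [e] at this
    refine this.congr_deriv ?_
    field_simp
  have du1 : ∀ s ∈ Ioo (0:ℝ) 1, HasDerivAt u1 (f s (u s) / ε ^ 2) s := by
    intro s hs
    have := (H.d1 s hs).const_mul (ε ^ 2)⁻¹
    have e : (fun s => (ε ^ 2)⁻¹ * (ε ^ 2 * u1 s)) = u1 := by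
      funext s; field_simp
    rw [e] at this
    refine this.congr_deriv ?_
    field_simp
  -- windows of length ε
  have hwin : ∀ x ∈ Icc (0:ℝ) 1, ∃ p, 0 ≤ p ∧ p + ε ≤ 1 ∧ x ∈ Icc p (p + ε) := by
    intro x hx
    rcases le_total x (1 - ε) with h | h
    · exact ⟨x, hx.1, by linarith, ⟨le_rfl, by linarith⟩⟩
    · exact ⟨1 - ε, by linarith [hε.2], by linarith, ⟨h, by linarith [hx.2]⟩⟩
  have hcrude : ∀ x ∈ Icc (0:ℝ) 1, |u1 x| ≤ K1 * (1 / ε) := by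
    intro x hx
    obtain ⟨p, hp0, hp1, hxp⟩ := hwin x hx
    have s1 : Icc p (p + ε) ⊆ Icc 0 1 := Icc_subset_Icc hp0 hp1
    have s2 : Ioo p (p + ε) ⊆ Ioo 0 1 := Ioo_subset_Ioo hp0 hp1
    have := interp_deriv u u1 (fun s => f s (u s) / ε ^ 2) p ε L (M / ε ^ 2) hε0 (cu.mono s1) (cu1.mono s1)
      (fun s hs => du s (s2 hs)) (fun s hs => du1 s (s2 hs)) (fun s hs => (hB s (s1 hs)).1)
      (fun s hs => by
        rw [abs_div, abs_of_pos (by positivity : 0 < ε ^ 2)]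
        have := (hB s (Ioo_subset_Icc_self (s2 hs))).2.1
        gcongr) x hxp
    have e : 2 * L / ε + ε * (M / ε ^ 2) = (2 * L + M) * (1 / ε) := by field_simp
    rw [e] at this
    refine this.trans ?_
    gcongr
    have : 0 < M / c₀ ^ 2 := by positivity
    linarith
  have hu1b : ∀ x ∈ Icc (0:ℝ) 1, |u1 x| ≤ K1 * (1 + 1 / ε * lay δ ε x) := by
    refine barrier c₀ δ ε K1 1 (1 / ε) hε0 hK1p.le (by norm_num) (by positivity) u1 
      (fun s => f s (u s) / ε ^ 2) (fun s => g1 s / ε ^ 2) b cu1 du1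
      (fun s hs => (H.d2 s hs).div_const _) (fun s hs => (hB s (Ioo_subset_Icc_self hs)).2.2.2.2.1)
      ?_ (hcrude 0 (by simp)) (hcrude 1 (by simp))
    intro s hs
    obtain ⟨-, -, hA, -, -, hg1, -⟩ := hB s (Ioo_subset_Icc_self hs)
    have e : ε ^ 2 * (g1 s / ε ^ 2) - b s * u1 s = A s := by
      rw [hg1]; field_simp; ring
    rw [e]
    have hl := lay_pos δ ε s
    have : 0 < K1 * ((c₀ ^ 2 - δ ^ 2) * (1 / ε * lay δ ε s)) := by
      have : 0 < c₀ ^ 2 - δ ^ 2 := by rw [hδc]; linarith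
      positivity
    have h3 : M < K1 * c₀ ^ 2 := by
      rw [hK1]
      have : M / c₀ ^ 2 * c₀ ^ 2 = M := by field_simp
      nlinarith
    nlinarith
  have hu1sq : ∀ x ∈ Icc (0:ℝ) 1, M * (1 + u1 x ^ 2) ≤ N * (1 + lay δ ε x / ε ^ 2) := by
    intro x hx
    have h1 := hu1b x hx
    have hl := lay_pos δ ε x
    have hl2 := lay_le_two δ ε x hδ0 hε0 hx
    have h2 : u1 x ^ 2 ≤ (K1 * (1 + 1 / ε * lay δ ε x)) ^ 2 := by
      rw [← sq_abs]; gcongr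
    have h3 : (1 + 1 / ε * lay δ ε x) ^ 2 ≤ 2 + 4 * (lay δ ε x / ε ^ 2) := by
      have e : (1 / ε * lay δ ε x) ^ 2 = lay δ ε x * lay δ ε x / ε ^ 2 := by field_simp
      have : lay δ ε x * lay δ ε x / ε ^ 2 ≤ 2 * lay δ ε x / ε ^ 2 := by gcongr
      have e2 : 2 * lay δ ε x / ε ^ 2 = 2 * (lay δ ε x / ε ^ 2) := by ring
      nlinarith [sq_nonneg (1 - 1 / ε * lay δ ε x)]
    have hl3 : 0 < lay δ ε x / ε ^ 2 := by positivity
    rw [hN, mul_assoc]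
    gcongr
    have : K1 ^ 2 * (1 + 1 / ε * lay δ ε x) ^ 2 ≤ K1 ^ 2 * (2 + 4 * (lay δ ε x / ε ^ 2)) := by gcongr
    have : 0 < K1 ^ 2 := by positivity
    nlinarith
  have hg : ∀ x ∈ Icc (0:ℝ) 1, |f x (u x)| ≤ K2 * (ε ^ 2 + 1 * lay δ ε x) := by
    refine barrier c₀ δ ε K2 (ε ^ 2) 1 hε0 hK2p.le (by positivity) (by positivity) (fun s => f s (u s)) 
      g1 g2 b H.c2 H.d2 H.d3 (fun s hs => (hB s (Ioo_subset_Icc_self hs)).2.2.2.2.1)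
      ?_ ?_ ?_
    · intro s hs
      have hs' := Ioo_subset_Icc_self hs
      obtain ⟨-, -, -, -, -, -, hg2⟩ := hB s hs'
      have e : ε ^ 2 * g2 s - b s * f s (u s) = ε ^ 2 * (g2 s - b s * (f s (u s) / ε ^ 2)) := by
        field_simp
      have hl := lay_pos δ ε s
      rw [e, abs_mul, abs_of_pos (by positivity : 0 < ε ^ 2)]
      have h1 := hg2.trans (hu1sq s hs')
      have h2 : ε ^ 2 * |g2 s - b s * (f s (u s) / ε ^ 2)| ≤ ε ^ 2 * (N * (1 + lay δ ε s / ε ^ 2)) := by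
        gcongr
      have e2 : ε ^ 2 * (N * (1 + lay δ ε s / ε ^ 2)) = N * (ε ^ 2 + lay δ ε s) := by
        field_simp
      rw [e2] at h2
      refine lt_of_le_of_lt h2 ?_
      have h3 : 2 * N ≤ K2 * c₀ ^ 2 := by
        rw [hK2]
        have : 2 * N / c₀ ^ 2 * c₀ ^ 2 = 2 * N := by field_simp
        nlinarith
      rw [hδc]
      have h4 : 0 < ε ^ 2 := by positivity
      have h5 : 2 * N * ε ^ 2 ≤ K2 * c₀ ^ 2 * ε ^ 2 := by gcongr
      have h6 : 2 * N * lay δ ε s ≤ K2 * c₀ ^ 2 * lay δ ε s := by gcongr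
      have h7 : 0 < N * ε ^ 2 := by positivity
      have h8 : 0 < N * lay δ ε s := by positivity
      nlinarith
    · have := (hB 0 (by simp)).2.1
      have : 0 < 2 * N / c₀ ^ 2 := by positivity
      linarith
    · have := (hB 1 (by simp)).2.1
      have : 0 < 2 * N / c₀ ^ 2 := by positivity
      linarith
  have hg' : ∀ x ∈ Icc (0:ℝ) 1, |f x (u x)| ≤ K2 * (ε ^ 2 + lay δ ε x) := by
    intro x hx
    have := hg x hx
    rwa [one_mul] at this
  have hg2 : ∀ x ∈ Icc (0:ℝ) 1, |g2 x| ≤ K3 * (1 + lay δ ε x / ε ^ 2) := by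
    intro x hx
    obtain ⟨-, -, -, hb, -, -, h2⟩ := hB x hx
    have h1 := h2.trans (hu1sq x hx)
    have h3 := abs_sub_abs_le_abs_sub (g2 x) (b x * (f x (u x) / ε ^ 2))
    have hl := lay_pos δ ε x
    have h4 : |b x * (f x (u x) / ε ^ 2)| ≤ M * (K2 * (1 + lay δ ε x / ε ^ 2)) := by
      rw [abs_mul, abs_div, abs_of_pos (by positivity : 0 < ε ^ 2)]
      have e : K2 * (1 + lay δ ε x / ε ^ 2) = K2 * (ε ^ 2 + lay δ ε x) / ε ^ 2 := by field_simp
      rw [e]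
      have := hg' x hx
      gcongr
    rw [hK3]
    linarith
  intro x hx
  have hl := lay_pos δ ε x
  have hmono : ∀ K' Z : ℝ, 0 ≤ K' → K' ≤ 2 * K2 + K3 → 0 < Z → K' * Z ≤ (2 * K2 + K3) * Real.exp δ * Z := by
    intro K' Z h0 h1 hZ
    have : K' ≤ (2 * K2 + K3) * Real.exp δ := by nlinarith
    gcongr
  refine ⟨(hg' x hx).trans (hmono _ _ hK2p.le (by linarith) (by positivity)), ?_,
    (hg2 x hx).trans (hmono _ _ hK3p.le (by linarith) (by positivity))⟩
  obtain ⟨p, hp0, hp1, hxp⟩ := hwin x hx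
  have s1 : Icc p (p + ε) ⊆ Icc 0 1 := Icc_subset_Icc hp0 hp1
  have s2 : Ioo p (p + ε) ⊆ Ioo 0 1 := Ioo_subset_Ioo hp0 hp1
  have hnear : ∀ s ∈ Icc p (p + ε), lay δ ε s ≤ Real.exp δ * lay δ ε x := by
    intro s hs
    apply lay_near δ ε x s hδ0 hε0
    rw [abs_le]
    constructor <;> linarith [hs.1, hs.2, hxp.1, hxp.2]
  have := interp_deriv (fun s => f s (u s)) g1 g2 p ε (K2 * (ε ^ 2 + Real.exp δ * lay δ ε x))
    (K3 * (1 + Real.exp δ * lay δ ε x / ε ^ 2)) hε0 (H.c2.mono s1) (H.c3.mono s1)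
    (fun s hs => H.d2 s (s2 hs)) (fun s hs => H.d3 s (s2 hs))
    (fun s hs => by
      refine (hg' s (s1 hs)).trans ?_
      have := hnear s hs
      gcongr)
    (fun s hs => by
      refine (hg2 s (Ioo_subset_Icc_self (s2 hs))).trans ?_
      have := hnear s (Ioo_subset_Icc_self hs)
      gcongr) x hxp
  refine this.trans ?_
  have e : 2 * (K2 * (ε ^ 2 + Real.exp δ * lay δ ε x)) / ε + ε * (K3 * (1 + Real.exp δ * lay δ ε x / ε ^ 2))
      = (2 * K2 + K3) * (ε + Real.exp δ * (lay δ ε x / ε)) := by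
    field_simp
  rw [e, mul_assoc]
  gcongr
  rw [mul_add]
  have : ε ≤ Real.exp δ * ε := by nlinarith
  linarith

/-- discrete comparison -/
lemma disc_stab (f : ℝ → ℝ → ℝ) (c₀ : ℝ) (hc₀ : 0 < c₀) (hfu : LowerF f c₀) (ε : ℝ)
    (x : ℕ → ℝ) (n : ℕ) (hx : ∀ i < n, x i < x (i + 1)) (hxI : ∀ i ≤ n, x i ∈ Icc (0:ℝ) 1)
    (v y : ℕ → ℝ) (T : ℝ) (hT : 0 ≤ T)
    (hcmp : ∀ i, 1 ≤ i → i < n →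
      -ε ^ 2 * ddiff x v i + f (x i) (v i) ≤ -ε ^ 2 * ddiff x y i + f (x i) (y i) + T)
    (h0 : v 0 ≤ y 0) (hn : v n ≤ y n) : ∀ i ≤ n, v i - y i ≤ T / c₀ ^ 2 := by
  have hc2 : 0 < c₀ ^ 2 := by positivity
  obtain ⟨m, hm, hmax⟩ := Finset.exists_max_image (Finset.range (n + 1)) (fun i => v i - y i) ⟨0, by simp⟩
  simp only [Finset.mem_range] at hm hmax
  have hTc : 0 ≤ T / c₀ ^ 2 := by positivity
  suffices h : v m - y m ≤ T / c₀ ^ 2 by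
    intro i hi
    exact (hmax i (by omega)).trans h
  rcases Nat.eq_zero_or_pos m with rfl | hmpos
  · linarith
  rcases (by omega : m = n ∨ m < n) with rfl | hmn
  · linarith
  by_contra hcon
  push Not at hcon
  have hpos : 0 < v m - y m := by linarith
  have h1 := hcmp m hmpos hmn
  have h2 := f_mono f c₀ hc₀ hfu (x m) (hxI m hmn.le) (y m) (v m) (by linarith)
  have h3 : T < c₀ ^ 2 * (v m - y m) := by
    rw [div_lt_iff₀ hc2] at hcon
    linarith
  obtain ⟨j, rfl⟩ : ∃ j, m = j + 1 := ⟨m - 1, by omega⟩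
  have a1 := hx j (by omega)
  have a2 := hx (j + 1) hmn
  have m1 := hmax j (by omega)
  have m2 := hmax (j + 1 + 1) (by omega)
  have h4 : ddiff x v (j + 1) - ddiff x y (j + 1) ≤ 0 := by
    unfold ddiff
    simp only [Nat.add_sub_cancel]
    rw [← mul_sub]
    apply mul_nonpos_of_nonneg_of_nonpos
    · apply div_nonneg (by norm_num); linarith
    · have e1 : (v (j + 1 + 1) - v (j + 1)) / (x (j + 1 + 1) - x (j + 1))
          ≤ (y (j + 1 + 1) - y (j + 1)) / (x (j + 1 + 1) - x (j + 1)) := by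
        apply div_le_div_of_nonneg_right <;> linarith
      have e2 : (y (j + 1) - y j) / (x (j + 1) - x j)
          ≤ (v (j + 1) - v j) / (x (j + 1) - x j) := by
        apply div_le_div_of_nonneg_right <;> linarith
      linarith
  have : 0 ≤ ε ^ 2 := by positivity
  nlinarith

/-- shooting sequence -/
def shoot (h w : ℕ → ℝ) (φ : ℕ → ℝ → ℝ) (s : ℝ) : ℕ → ℝ × ℝ
  | 0 => (0, s)
  | i + 1 => ((shoot h w φ s i).1 + h i * (shoot h w φ s i).2,
      (shoot h w φ s i).2 + w (i + 1) * φ (i + 1)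
        ((shoot h w φ s i).1 + h i * (shoot h w φ s i).2))

lemma shoot_cont (h w : ℕ → ℝ) (φ : ℕ → ℝ → ℝ) (hφ : ∀ i, Continuous (φ i)) (i : ℕ) :
    Continuous (fun s => shoot h w φ s i) := by
  induction i with
  | zero => simp only [shoot]; fun_prop
  | succ i ih =>
    have := hφ (i + 1)
    simp only [shoot]
    fun_prop

lemma shoot_mono (h w : ℕ → ℝ) (φ : ℕ → ℝ → ℝ) (hh : ∀ i, 0 < h i) (hw : ∀ i, 0 ≤ w i)
    (hφ : ∀ i, Monotone (φ i)) (s s' : ℝ) (hs : s ≤ s') (i : ℕ) :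
    (∑ j ∈ Finset.range i, h j) * (s' - s) ≤ (shoot h w φ s' i).1 - (shoot h w φ s i).1 ∧
    s' - s ≤ (shoot h w φ s' i).2 - (shoot h w φ s i).2 := by
  induction i with
  | zero => simp [shoot]
  | succ i ih =>
    obtain ⟨h1, h2⟩ := ih
    have hh' := hh i
    have hS : 0 ≤ (∑ j ∈ Finset.range i, h j) * (s' - s) :=
      mul_nonneg (Finset.sum_nonneg fun j _ => (hh j).le) (by linarith)
    have k1 : h i * (s' - s) ≤ h i * ((shoot h w φ s' i).2 - (shoot h w φ s i).2) := by gcongr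
    have k0 : 0 ≤ h i * (s' - s) := mul_nonneg hh'.le (by linarith)
    have k2 := hφ (i + 1) (show (shoot h w φ s i).1 + h i * (shoot h w φ s i).2 ≤
      (shoot h w φ s' i).1 + h i * (shoot h w φ s' i).2 by linarith)
    have k3 := mul_le_mul_of_nonneg_left k2 (hw (i + 1))
    simp only [shoot, Finset.sum_range_succ]
    constructor
    · rw [add_mul]; linarith
    · linarith

lemma shoot_exists (h w : ℕ → ℝ) (φ : ℕ → ℝ → ℝ) (hh : ∀ i, 0 < h i) (hw : ∀ i, 0 ≤ w i)
    (hφ : ∀ i, Monotone (φ i)) (hφc : ∀ i, Continuous (φ i)) (n : ℕ) (hn : 1 ≤ n) :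
    ∃ s, (shoot h w φ s n).1 = 0 := by
  set Z : ℝ → ℝ := fun s => (shoot h w φ s n).1 with hZ
  have hc : Continuous Z := (shoot_cont h w φ hφc n).fst
  set S := ∑ j ∈ Finset.range n, h j with hSd
  have hS : 0 < S := Finset.sum_pos (fun j _ => hh j) ⟨0, by simp; omega⟩
  set r := |Z 0| / S with hr
  have hr0 : 0 ≤ r := by positivity
  have hrS : S * r = |Z 0| := by rw [hr]; field_simp
  have h1 := (shoot_mono h w φ hh hw hφ 0 r hr0 n).1
  have h2 := (shoot_mono h w φ hh hw hφ (-r) 0 (by linarith) n).1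
  have e1 : Z (-r) ≤ 0 := by
    have := le_abs_self (Z 0)
    simp only [hZ] at *
    nlinarith
  have e2 : 0 ≤ Z r := by
    have := neg_abs_le (Z 0)
    simp only [hZ] at *
    nlinarith
  obtain ⟨s, -, hs⟩ := intermediate_value_Icc (by linarith : -r ≤ r) hc.continuousOn ⟨e1, e2⟩
  exact ⟨s, hs⟩

lemma disc_exists (f : ℝ → ℝ → ℝ) (c₀ : ℝ) (hc₀ : 0 < c₀) (hfu : LowerF f c₀) (ε : ℝ) (hε : 0 < ε)
    (x : ℕ → ℝ) (n : ℕ) (hn : 1 ≤ n) (hx : ∀ i < n, x i < x (i + 1))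
    (hxI : ∀ i ≤ n, x i ∈ Icc (0:ℝ) 1) :
    ∃ y, NonlinScheme f ε x n y := by
  set h : ℕ → ℝ := fun i => if i < n then x (i + 1) - x i else 1 with hhd
  set w : ℕ → ℝ := fun i => (h (i - 1) + h i) / (2 * ε ^ 2) with hwd
  set φ : ℕ → ℝ → ℝ := fun i => if i ≤ n then f (x i) else fun _ => 0 with hφd
  have hh : ∀ i, 0 < h i := by
    intro i
    simp only [hhd]
    split_ifs with hi
    · linarith [hx i hi]
    · norm_num
  have hw : ∀ i, 0 ≤ w i := by
    intro i
    have := hh i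
    have := hh (i - 1)
    simp only [hwd]
    positivity
  have hφ : ∀ i, Monotone (φ i) := by
    intro i
    simp only [hφd]
    split_ifs with hi
    · intro y z hyz
      have := f_mono f c₀ hc₀ hfu (x i) (hxI i hi) y z hyz
      have : 0 ≤ c₀ ^ 2 * (z - y) := mul_nonneg (by positivity) (by linarith)
      linarith
    · exact monotone_const
  have hφc : ∀ i, Continuous (φ i) := by
    intro i
    simp only [hφd]
    split_ifs with hi
    · have hd : Differentiable ℝ (fun z => f (x i) z) := by
        intro w
        by_contra hcon
        have h1 := hfu (x i) (hxI i hi) w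
        unfold pderiv1 at h1
        rw [deriv_zero_of_not_differentiableAt hcon] at h1
        have : 0 < c₀ ^ 2 := by positivity
        linarith
      exact hd.continuous
    · exact continuous_const
  obtain ⟨s, hs⟩ := shoot_exists h w φ hh hw hφ hφc n hn
  refine ⟨fun i => (shoot h w φ s i).1, ?_, by simp [shoot], hs⟩
  intro i hi hin
  obtain ⟨j, rfl⟩ : ∃ j, i = j + 1 := ⟨i - 1, by omega⟩
  have e1 : h j = x (j + 1) - x j := by simp [hhd]; omega
  have e2 : h (j + 1) = x (j + 1 + 1) - x (j + 1) := by simp [hhd]; omega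
  have e3 : φ (j + 1) = f (x (j + 1)) := by simp [hφd]; omega
  have p1 := hh j
  have p2 := hh (j + 1)
  have s1 : (shoot h w φ s (j + 1)).1 = (shoot h w φ s j).1 + h j * (shoot h w φ s j).2 := rfl
  have s2 : (shoot h w φ s (j + 1 + 1)).1
      = (shoot h w φ s (j + 1)).1 + h (j + 1) * (shoot h w φ s (j + 1)).2 := rfl
  have s3 : (shoot h w φ s (j + 1)).2 = (shoot h w φ s j).2 + w (j + 1) * φ (j + 1)
      ((shoot h w φ s (j + 1)).1) := rfl
  have w1 : w (j + 1) = (h j + h (j + 1)) / (2 * ε ^ 2) := rfl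
  unfold ddiff
  simp only [Nat.add_sub_cancel]
  rw [← e1, ← e2, s2, add_sub_cancel_left, mul_div_cancel_left₀ _ p2.ne']
  have t1 : ((shoot h w φ s (j + 1)).1 - (shoot h w φ s j).1) / h j = (shoot h w φ s j).2 := by
    rw [s1, add_sub_cancel_left, mul_div_cancel_left₀ _ p1.ne']
  have t2 : x (j + 1 + 1) - x j = h j + h (j + 1) := by rw [e1, e2]; ring
  rw [t1, t2, s3, w1, e3]
  have : h j + h (j + 1) ≠ 0 := by linarith
  field_simp
  ring

/-! ### The mesh -/

/-- distance function of the mesh -/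
def Qf (a ε q t : ℝ) : ℝ := max (q - t) (q - vulAlpha a ε q)

/-- unified formula for the mesh generating function on the left -/
def Mf (a ε q t : ℝ) : ℝ :=
  a * ε * (q * (2 / Qf a ε q t + (t - q) / (Qf a ε q t) ^ 2) - 1)

/-- slope of the mesh generating function -/
def Lf (a ε q t : ℝ) : ℝ := a * ε * q / (Qf a ε q t) ^ 2

lemma alpha_facts (a ε q : ℝ) (hq : q ∈ Ioo (0:ℝ) (1/2)) (he : 0 < a * ε) (heq : a * ε < q) :
    0 < vulAlpha a ε q ∧ vulAlpha a ε q < q ∧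
    (q - vulAlpha a ε q) ^ 2 = a * ε * (q - 2 * (vulAlpha a ε q) ^ 2) := by
  obtain ⟨hq0, hq1⟩ := hq
  unfold vulAlpha
  obtain ⟨e, hed⟩ : ∃ e, e = a * ε := ⟨_, rfl⟩
  have e1 : ε * a * q * (1 - 2 * q + 2 * ε * a) = e * q * (1 - 2 * q + 2 * e) := by rw [hed]; ring
  have e2 : 1 + 2 * ε * a = 1 + 2 * e := by rw [hed]; ring
  rw [e1, e2, ← hed]
  rw [← hed] at he heq
  have hin : 0 < e * q * (1 - 2 * q + 2 * e) := by
    have : 0 < 1 - 2 * q + 2 * e := by linarith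
    positivity
  set s := Real.sqrt (e * q * (1 - 2 * q + 2 * e)) with hs
  have hs0 : 0 < s := Real.sqrt_pos.2 hin
  have hs2 : s ^ 2 = e * q * (1 - 2 * q + 2 * e) := Real.sq_sqrt hin.le
  have hsq : s < q := by
    apply lt_of_pow_lt_pow_left₀ 2 hq0.le
    rw [hs2]
    have : e * (1 - 2 * q + 2 * e) < q := by nlinarith
    nlinarith
  have hp : 0 < 1 + 2 * e := by linarith
  refine ⟨div_pos (by linarith) hp, ?_, ?_⟩
  · rw [div_lt_iff₀ hp]; nlinarith
  · obtain ⟨α, hα⟩ : ∃ α, α = (q - s) / (1 + 2 * e) := ⟨_, rfl⟩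
    rw [← hα]
    have h1 : s = q - (1 + 2 * e) * α := by rw [hα]; field_simp; ring
    rw [h1] at hs2
    have h2 : (1 + 2 * e) * ((q - α) ^ 2 - e * (q - 2 * α ^ 2)) = 0 := by linarith
    rcases mul_eq_zero.1 h2 with h | h <;> linarith

section mesh
variable (a ε q : ℝ)

lemma Qf_pos (hq : q ∈ Ioo (0:ℝ) (1/2)) (he : 0 < a * ε) (heq : a * ε < q) (t : ℝ) :
    0 < Qf a ε q t := by
  have := (alpha_facts a ε q hq he heq).2.1
  exact lt_of_lt_of_le (by linarith) (le_max_right _ _)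

lemma Qf_ge (t : ℝ) : q - t ≤ Qf a ε q t := le_max_left _ _

lemma Qf_anti (s t : ℝ) (h : s ≤ t) : Qf a ε q t ≤ Qf a ε q s := by
  unfold Qf; exact max_le_max (by linarith) le_rfl

lemma Qf_lip (s t : ℝ) (h : s ≤ t) : Qf a ε q s ≤ Qf a ε q t + (t - s) := by
  unfold Qf
  apply max_le
  · have := le_max_left (q - t) (q - vulAlpha a ε q); linarith
  · have := le_max_right (q - t) (q - vulAlpha a ε q); linarith

lemma Mf_tangent (hq : q ∈ Ioo (0:ℝ) (1/2)) (he : 0 < a * ε) (heq : a * ε < q) (s t : ℝ) :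
    Mf a ε q t + Lf a ε q t * (s - t) ≤ Mf a ε q s := by
  have hs := Qf_pos a ε q hq he heq s
  have ht := Qf_pos a ε q hq he heq t
  have hq0 := hq.1
  have key : 0 ≤ 2 / Qf a ε q s - 2 / Qf a ε q t
      + (s - q) * (1 / Qf a ε q s ^ 2 - 1 / Qf a ε q t ^ 2) := by
    have hcase : s - q = -Qf a ε q s ∨ (-Qf a ε q s ≤ s - q ∧ Qf a ε q s ≤ Qf a ε q t) := by
      rcases le_total (q - s) (q - vulAlpha a ε q) with h | h
      · right
        refine ⟨by linarith [Qf_ge a ε q s], ?_⟩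
        have : Qf a ε q s = q - vulAlpha a ε q := max_eq_right h
        rw [this]
        exact le_max_right _ _
      · left
        have : Qf a ε q s = q - s := max_eq_left h
        rw [this]; ring
    have base : 0 ≤ 2 / Qf a ε q s - 2 / Qf a ε q t
      + (-Qf a ε q s) * (1 / Qf a ε q s ^ 2 - 1 / Qf a ε q t ^ 2) := by
      have e : 2 / Qf a ε q s - 2 / Qf a ε q t
          + (-Qf a ε q s) * (1 / Qf a ε q s ^ 2 - 1 / Qf a ε q t ^ 2)
          = (Qf a ε q t - Qf a ε q s) ^ 2 / (Qf a ε q s * Qf a ε q t ^ 2) := by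
        field_simp; ring
      rw [e]; positivity
    rcases hcase with h | ⟨h1, h2⟩
    · rw [h]; exact base
    · have h3 : 0 ≤ 1 / Qf a ε q s ^ 2 - 1 / Qf a ε q t ^ 2 := by
        rw [sub_nonneg]
        gcongr
      nlinarith
  have e : Mf a ε q s - (Mf a ε q t + Lf a ε q t * (s - t)) =
      a * ε * q * (2 / Qf a ε q s - 2 / Qf a ε q t
      + (s - q) * (1 / Qf a ε q s ^ 2 - 1 / Qf a ε q t ^ 2)) := by
    unfold Mf Lf; ring
  have : 0 ≤ a * ε * q * (2 / Qf a ε q s - 2 / Qf a ε q t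
      + (s - q) * (1 / Qf a ε q s ^ 2 - 1 / Qf a ε q t ^ 2)) := by positivity
  linarith

lemma Lf_pos (hq : q ∈ Ioo (0:ℝ) (1/2)) (he : 0 < a * ε) (heq : a * ε < q) (t : ℝ) :
    0 < Lf a ε q t := by
  have ht := Qf_pos a ε q hq he heq t
  have hq0 := hq.1
  unfold Lf; positivity

lemma Mf_strictMono (hq : q ∈ Ioo (0:ℝ) (1/2)) (he : 0 < a * ε) (heq : a * ε < q) :
    StrictMono (Mf a ε q) := by
  intro s t hst
  have := Mf_tangent a ε q hq he heq t s
  have h := Lf_pos a ε q hq he heq s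
  have : 0 < Lf a ε q s * (t - s) := mul_pos h (by linarith)
  linarith

lemma Mf_half (hq : q ∈ Ioo (0:ℝ) (1/2)) (he : 0 < a * ε) (heq : a * ε < q) :
    Mf a ε q (1/2) = 1/2 := by
  obtain ⟨h1, h2, h3⟩ := alpha_facts a ε q hq he heq
  have hQ : Qf a ε q (1/2) = q - vulAlpha a ε q := max_eq_right (by linarith [hq.2])
  unfold Mf
  rw [hQ]
  have hne : q - vulAlpha a ε q ≠ 0 := by linarith
  have e : a * ε * (q * (2 / (q - vulAlpha a ε q) + (1/2 - q) / (q - vulAlpha a ε q) ^ 2) - 1)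
    = a * ε * (q / 2 - vulAlpha a ε q ^ 2) / (q - vulAlpha a ε q) ^ 2 := by
    field_simp; ring
  rw [e, h3, div_eq_iff]
  · ring
  · rw [← h3]; positivity

/-- affine part -/
lemma Mf_affine (hq : q ∈ Ioo (0:ℝ) (1/2)) (he : 0 < a * ε) (heq : a * ε < q) (t : ℝ)
    (ht : vulAlpha a ε q ≤ t) : Mf a ε q t = 1/2 + Lf a ε q (1/2) * (t - 1/2) := by
  obtain ⟨h1, h2, h3⟩ := alpha_facts a ε q hq he heq
  have hQ : Qf a ε q (1/2) = q - vulAlpha a ε q := max_eq_right (by linarith [hq.2])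
  have hQt : Qf a ε q t = q - vulAlpha a ε q := max_eq_right (by linarith)
  have h := Mf_half a ε q hq he heq
  unfold Mf at h ⊢
  unfold Lf
  rw [hQ] at h ⊢
  rw [hQt]
  linear_combination h

lemma Mf_zero (hq : q ∈ Ioo (0:ℝ) (1/2)) (he : 0 < a * ε) (heq : a * ε < q) :
    Mf a ε q 0 = 0 := by
  obtain ⟨h1, h2, h3⟩ := alpha_facts a ε q hq he heq
  have hQ : Qf a ε q 0 = q := by unfold Qf; rw [max_eq_left (by linarith)]; ring
  unfold Mf
  rw [hQ]
  have := hq.1.ne'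
  field_simp; ring

lemma Mf_eq_left (hq : q ∈ Ioo (0:ℝ) (1/2)) (he : 0 < a * ε) (heq : a * ε < q) (t : ℝ) :
    (if t ≤ vulAlpha a ε q then vulMu a ε q t
      else vulMu a ε q (vulAlpha a ε q) + vulMu' a ε q (vulAlpha a ε q) * (t - vulAlpha a ε q))
      = Mf a ε q t := by
  obtain ⟨h1, h2, h3⟩ := alpha_facts a ε q hq he heq
  unfold Mf vulMu vulMu'
  have hne : q - vulAlpha a ε q ≠ 0 := by linarith
  split_ifs with h
  · have hQ : Qf a ε q t = q - t := max_eq_left (by linarith)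
    have : q - t ≠ 0 := by linarith
    rw [hQ]; field_simp; ring
  · have hQ : Qf a ε q t = q - vulAlpha a ε q := max_eq_right (by linarith)
    rw [hQ]; field_simp; ring

lemma vulLam_left (hq : q ∈ Ioo (0:ℝ) (1/2)) (he : 0 < a * ε) (heq : a * ε < q) (t : ℝ)
    (ht : t ≤ 1/2) : vulLam a ε q t = Mf a ε q t := by
  rw [← Mf_eq_left a ε q hq he heq t]
  unfold vulLam
  simp only [ht, if_true]

lemma vulLam_right (hq : q ∈ Ioo (0:ℝ) (1/2)) (he : 0 < a * ε) (heq : a * ε < q) (t : ℝ)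
    (ht : 1/2 < t) : vulLam a ε q t = 1 - Mf a ε q (1 - t) := by
  obtain ⟨h1, h2, h3⟩ := alpha_facts a ε q hq he heq
  rw [← Mf_eq_left a ε q hq he heq (1 - t)]
  unfold vulLam
  have hα : ¬ t ≤ vulAlpha a ε q := by linarith [hq.2]
  simp only [not_le.2 ht, hα, if_false]

lemma vulLam_symm (hq : q ∈ Ioo (0:ℝ) (1/2)) (he : 0 < a * ε) (heq : a * ε < q) (t : ℝ) :
    vulLam a ε q (1 - t) = 1 - vulLam a ε q t := by
  rcases lt_trichotomy t (1/2) with h | h | h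
  · rw [vulLam_left a ε q hq he heq t h.le, vulLam_right a ε q hq he heq (1 - t) (by linarith)]
    ring_nf
  · rw [h]
    have : (1:ℝ) - 1/2 = 1/2 := by norm_num
    rw [this, vulLam_left a ε q hq he heq _ le_rfl, Mf_half a ε q hq he heq]
    norm_num
  · rw [vulLam_right a ε q hq he heq t h, vulLam_left a ε q hq he heq (1 - t) (by linarith)]
    ring

lemma vulLam_mid (hq : q ∈ Ioo (0:ℝ) (1/2)) (he : 0 < a * ε) (heq : a * ε < q) (t : ℝ)
    (ht : t ≤ 1 - vulAlpha a ε q) : vulLam a ε q t = Mf a ε q t := by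
  obtain ⟨h1, h2, h3⟩ := alpha_facts a ε q hq he heq
  rcases le_or_gt t (1/2) with h | h
  · exact vulLam_left a ε q hq he heq t h
  · rw [vulLam_right a ε q hq he heq t h, Mf_affine a ε q hq he heq t (by linarith [hq.2]),
      Mf_affine a ε q hq he heq (1 - t) (by linarith)]
    ring

lemma vulLam_strictMono (hq : q ∈ Ioo (0:ℝ) (1/2)) (he : 0 < a * ε) (heq : a * ε < q) :
    StrictMono (vulLam a ε q) := by
  have hM := Mf_strictMono a ε q hq he heq
  have hh := Mf_half a ε q hq he heq
  intro s t hst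
  rcases le_or_gt t (1/2) with h | h
  · rw [vulLam_left a ε q hq he heq t h, vulLam_left a ε q hq he heq s (by linarith)]
    exact hM hst
  · rw [vulLam_right a ε q hq he heq t h]
    rcases le_or_gt s (1/2) with h' | h'
    · rw [vulLam_left a ε q hq he heq s h']
      have := hM.monotone h'
      have := hM (show 1 - t < 1/2 by linarith)
      linarith
    · rw [vulLam_right a ε q hq he heq s h']
      have := hM (show 1 - t < 1 - s by linarith)
      linarith

lemma vulLam_zero (hq : q ∈ Ioo (0:ℝ) (1/2)) (he : 0 < a * ε) (heq : a * ε < q) :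
    vulLam a ε q 0 = 0 := by
  rw [vulLam_left a ε q hq he heq 0 (by norm_num), Mf_zero a ε q hq he heq]

lemma vulLam_one (hq : q ∈ Ioo (0:ℝ) (1/2)) (he : 0 < a * ε) (heq : a * ε < q) :
    vulLam a ε q 1 = 1 := by
  have := vulLam_symm a ε q hq he heq 0
  rw [vulLam_zero a ε q hq he heq] at this
  simpa using this

end mesh

/-- local smallness of the consistency error, in terms of three consecutive nodes -/
def Good (δ ε C d p x r : ℝ) : Prop :=
  2 * (ε ^ 2 + (Real.exp (-δ * p / ε) + Real.exp (-δ * (1 - r) / ε))) ≤ C * d ^ 2 ∨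
  |(r - x) - (x - p)| * (ε + (Real.exp (-δ * p / ε) + Real.exp (-δ * (1 - r) / ε)) / ε)
    + ((x - p) ^ 2 + (r - x) ^ 2) *
      (1 + (Real.exp (-δ * p / ε) + Real.exp (-δ * (1 - r) / ε)) / ε ^ 2) ≤ C * d ^ 2

lemma exp_neg_le (y : ℝ) (hy : 0 < y) : Real.exp (-y) ≤ 24 / y ^ 4 := by
  have h := Real.pow_div_factorial_le_exp y hy.le 4
  rw [Real.exp_neg, inv_le_comm₀ (Real.exp_pos _) (by positivity), inv_div]
  norm_num [Nat.factorial] at h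
  exact h

set_option maxHeartbeats 1600000 in
lemma mesh_core (q a δ : ℝ) (hq : q ∈ Ioo (0:ℝ) (1/2)) (ha : 0 < a) (hδ : 0 < δ) :
    ∃ C : ℝ, 0 < C ∧ ∀ ε ∈ Ioc (0:ℝ) 1, a * ε < q → ∀ d t : ℝ, 0 < d → 0 ≤ t - d → t ≤ 1/2 →
      d ≤ 1/2 - q →
      Good δ ε C d (vulLam a ε q (t - d)) (vulLam a ε q t) (vulLam a ε q (t + d)) := by
  have hq0 := hq.1
  have hq1 := hq.2
  obtain ⟨c, hc⟩ : ∃ c, c = a * q * (1 - 2 * q) := ⟨_, rfl⟩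
  have hcp : 0 < c := by
    rw [hc]
    have : 0 < 1 - 2 * q := by linarith
    positivity
  obtain ⟨D, hD⟩ : ∃ D, D = 2 * Real.exp (δ * a) * (24 / (δ * a * q) ^ 4) := ⟨_, rfl⟩
  have hDp : 0 < D := by rw [hD]; positivity
  obtain ⟨C1, hC1⟩ : ∃ C1, C1 = 2 * (1 / c + 9 * D) := ⟨_, rfl⟩
  obtain ⟨C2, hC2⟩ : ∃ C2, C2 = 4 * a * q * (1 / c ^ 2 + 81 * D)
    + 2 * a ^ 2 * q ^ 2 * (1 / c ^ 2 + 81 * D) := ⟨_, rfl⟩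
  have hC1p : 0 < C1 := by rw [hC1]; positivity
  have hC2p : 0 < C2 := by rw [hC2]; positivity
  refine ⟨C1 + C2, by positivity, ?_⟩
  intro ε hε heq d t hd htd ht hdq
  have hε0 : 0 < ε := hε.1
  have he : 0 < a * ε := by positivity
  obtain ⟨hα0, hαq, hαe⟩ := alpha_facts a ε q hq he heq
  have hM := Mf_strictMono a ε q hq he heq
  rw [vulLam_left a ε q hq he heq (t - d) (by linarith), vulLam_left a ε q hq he heq t ht,
    vulLam_mid a ε q hq he heq (t + d) (by linarith)]
  have T := Mf_tangent a ε q hq he heq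
  set Qm := Qf a ε q (t - d) with hQm
  set Qp := Qf a ε q (t + d) with hQp
  have hQpp : 0 < Qp := Qf_pos a ε q hq he heq _
  have hQmp : 0 < Qm := Qf_pos a ε q hq he heq _
  have hQle : Qp ≤ Qm := Qf_anti a ε q _ _ (by linarith)
  have hQlip : Qm ≤ Qp + 2 * d := by
    have := Qf_lip a ε q (t - d) (t + d) (by linarith)
    linarith
  have hQmq : Qm ≤ q := by
    rw [hQm]; unfold Qf
    exact max_le (by linarith) (by linarith)
  -- ε is controlled by Qp
  have hεQ : c * ε ≤ Qp ^ 2 := by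
    have h1 : q - vulAlpha a ε q ≤ Qp := le_max_right _ _
    have h2 : (q - vulAlpha a ε q) ^ 2 ≤ Qp ^ 2 := by
      apply pow_le_pow_left₀ (by linarith) h1
    have h3 : c * ε ≤ a * ε * (q - 2 * vulAlpha a ε q ^ 2) := by
      have : vulAlpha a ε q ^ 2 ≤ q ^ 2 := pow_le_pow_left₀ hα0.le hαq.le 2
      have : a * ε * (q - 2 * q ^ 2) ≤ a * ε * (q - 2 * vulAlpha a ε q ^ 2) := by
        gcongr
      rw [hc]; linarith
    linarith
  -- the exponentials
  set p := Mf a ε q (t - d) with hp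
  set x := Mf a ε q t with hx
  set r := Mf a ε q (t + d) with hr
  have hpr : p ≤ 1 - r := by
    have hh := Mf_half a ε q hq he heq
    rcases le_or_gt (t + d) (1/2) with h | h
    · have h1 := hM.monotone h
      have h2 := hM.monotone (show t - d ≤ 1/2 by linarith)
      linarith
    · have h1 := Mf_affine a ε q hq he heq (t + d) (by linarith)
      have h2 := Mf_affine a ε q hq he heq (1 - (t + d)) (by linarith)
      have h3 := hM.monotone (show t - d ≤ 1 - (t + d) by linarith)
      linarith
  have hplow : a * ε * (q / Qm - 1) ≤ p := by
    rw [hp]; unfold Mf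
    rw [← hQm]
    have h1 : -Qm ≤ t - d - q := by
      have := Qf_ge a ε q (t - d)
      linarith
    have h2 : -Qm / Qm ^ 2 ≤ (t - d - q) / Qm ^ 2 := by gcongr
    have h3 : -Qm / Qm ^ 2 = -(1 / Qm) := by field_simp
    have h4 : q / Qm = q * (2 / Qm + -(1 / Qm)) := by ring
    rw [h4]
    have : q * (2 / Qm + -(1 / Qm)) ≤ q * (2 / Qm + (t - d - q) / Qm ^ 2) := by
      gcongr
      linarith
    gcongr
  set E := Real.exp (-δ * p / ε) + Real.exp (-δ * (1 - r) / ε) with hE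
  have hE0 : 0 < E := by rw [hE]; positivity
  have hEle : E ≤ D * Qm ^ 4 := by
    have h1 : Real.exp (-δ * (1 - r) / ε) ≤ Real.exp (-δ * p / ε) := by
      apply Real.exp_le_exp.2
      gcongr ?_ / ε
      nlinarith
    have h2 : Real.exp (-δ * p / ε) ≤ Real.exp (δ * a) * Real.exp (-(δ * a * q / Qm)) := by
      rw [← Real.exp_add]
      apply Real.exp_le_exp.2
      rw [div_le_iff₀ hε0]
      have : δ * (a * ε * (q / Qm - 1)) ≤ δ * p := by gcongr
      have e : (δ * a + -(δ * a * q / Qm)) * ε = -(δ * (a * ε * (q / Qm - 1))) := by ring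
      rw [e]
      linarith
    have h3 := exp_neg_le (δ * a * q / Qm) (by positivity)
    have e : 24 / (δ * a * q / Qm) ^ 4 = 24 / (δ * a * q) ^ 4 * Qm ^ 4 := by field_simp
    rw [e] at h3
    have h4 : Real.exp (δ * a) * Real.exp (-(δ * a * q / Qm)) ≤
        Real.exp (δ * a) * (24 / (δ * a * q) ^ 4 * Qm ^ 4) := by gcongr
    rw [hD]
    linarith
  unfold Good
  rw [← hE]
  have hd2 : 0 < d ^ 2 := by positivity
  rcases le_or_gt Qm (3 * Qp) with hcase | hcase
  · -- regular case
    right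
    have hEp : E ≤ 81 * D * Qp ^ 4 := by
      have : Qm ^ 4 ≤ (3 * Qp) ^ 4 := pow_le_pow_left₀ hQmp.le hcase 4
      have : D * Qm ^ 4 ≤ D * (3 * Qp) ^ 4 := by gcongr
      nlinarith
    have hε2 : ε ^ 2 ≤ 1 / c ^ 2 * Qp ^ 4 := by
      have : (c * ε) ^ 2 ≤ (Qp ^ 2) ^ 2 := pow_le_pow_left₀ (by positivity) hεQ 2
      rw [div_mul_eq_mul_div, one_mul, le_div_iff₀ (by positivity)]
      nlinarith
    have hQp1 : Qp ≤ 1 := by linarith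
    -- step sizes
    have k0 : 0 ≤ r - x := by have := hM (show t < t + d by linarith); linarith
    have h0 : 0 ≤ x - p := by have := hM (show t - d < t by linarith); linarith
    have k1 : r - x ≤ a * ε * q / Qp ^ 2 * d := by
      have := T t (t + d)
      have e : Lf a ε q (t + d) = a * ε * q / Qp ^ 2 := rfl
      rw [e] at this
      linarith
    have h1 : x - p ≤ r - x := by
      have t1 := T (t + d) t
      have t2 := T (t - d) t
      linarith
    have hm1 : a * ε * q / Qm ^ 2 * d ≤ x - p := by
      have := T t (t - d)
      have e : Lf a ε q (t - d) = a * ε * q / Qm ^ 2 := rfl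
      rw [e] at this
      linarith
    have hdiff : |(r - x) - (x - p)| ≤ 4 * (a * ε * q) * d ^ 2 / Qp ^ 3 := by
      rw [abs_of_nonneg (by linarith)]
      have h2 : (r - x) - (x - p) ≤ a * ε * q * d * (1 / Qp ^ 2 - 1 / Qm ^ 2) := by
        have e : a * ε * q * d * (1 / Qp ^ 2 - 1 / Qm ^ 2)
          = a * ε * q / Qp ^ 2 * d - a * ε * q / Qm ^ 2 * d := by ring
        rw [e]; linarith
      have h3 : 1 / Qp ^ 2 - 1 / Qm ^ 2 ≤ 4 * d / Qp ^ 3 := by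
        have e : 1 / Qp ^ 2 - 1 / Qm ^ 2 = (Qm - Qp) * (Qm + Qp) / (Qp ^ 2 * Qm ^ 2) := by
          field_simp; ring
        rw [e, div_le_div_iff₀ (by positivity) (by positivity)]
        have i1 : (Qm - Qp) * (Qm + Qp) ≤ 2 * d * (2 * Qm) := by
          apply mul_le_mul <;> linarith
        have i2 : (Qm - Qp) * (Qm + Qp) * Qp ^ 3 ≤ 2 * d * (2 * Qm) * Qp ^ 3 := by gcongr
        have i3 : 2 * d * (2 * Qm) * Qp ^ 3 ≤ 4 * d * (Qp ^ 2 * Qm ^ 2) := by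
          have : 4 * d * Qm * Qp ^ 2 * Qp ≤ 4 * d * Qm * Qp ^ 2 * Qm := by gcongr
          nlinarith
        linarith
      have h4 : a * ε * q * d * (1 / Qp ^ 2 - 1 / Qm ^ 2) ≤ a * ε * q * d * (4 * d / Qp ^ 3) := by
        gcongr
      have e : a * ε * q * d * (4 * d / Qp ^ 3) = 4 * (a * ε * q) * d ^ 2 / Qp ^ 3 := by ring
      linarith
    have P1 : |(r - x) - (x - p)| * (ε + E / ε) ≤ 4 * a * q * (1 / c ^ 2 + 81 * D) * d ^ 2 := by
      have s1 : |(r - x) - (x - p)| * (ε + E / ε) ≤ 4 * (a * ε * q) * d ^ 2 / Qp ^ 3 * (ε + E / ε) := by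
        gcongr
      have e1 : 4 * (a * ε * q) * d ^ 2 / Qp ^ 3 * (ε + E / ε)
          = 4 * a * q * d ^ 2 * ((ε ^ 2 + E) / Qp ^ 3) := by
        field_simp
      have s2 : (ε ^ 2 + E) / Qp ^ 3 ≤ 1 / c ^ 2 + 81 * D := by
        rw [div_le_iff₀ (by positivity)]
        have : (1 / c ^ 2 + 81 * D) * (Qp ^ 3 * Qp) ≤ (1 / c ^ 2 + 81 * D) * (Qp ^ 3 * 1) := by gcongr
        linarith
      have s3 : 4 * a * q * d ^ 2 * ((ε ^ 2 + E) / Qp ^ 3) ≤ 4 * a * q * d ^ 2 * (1 / c ^ 2 + 81 * D) := by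
        gcongr
      linarith
    have P2 : ((x - p) ^ 2 + (r - x) ^ 2) * (1 + E / ε ^ 2)
        ≤ 2 * a ^ 2 * q ^ 2 * (1 / c ^ 2 + 81 * D) * d ^ 2 := by
      have s0 : (r - x) ^ 2 ≤ (a * ε * q / Qp ^ 2 * d) ^ 2 := pow_le_pow_left₀ k0 k1 2
      have s00 : (x - p) ^ 2 ≤ (a * ε * q / Qp ^ 2 * d) ^ 2 := pow_le_pow_left₀ h0 (h1.trans k1) 2
      have s1 : ((x - p) ^ 2 + (r - x) ^ 2) * (1 + E / ε ^ 2)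
          ≤ (2 * (a * ε * q / Qp ^ 2 * d) ^ 2) * (1 + E / ε ^ 2) := by
        gcongr
        linarith
      have e1 : (2 * (a * ε * q / Qp ^ 2 * d) ^ 2) * (1 + E / ε ^ 2)
          = 2 * a ^ 2 * q ^ 2 * d ^ 2 * ((ε ^ 2 + E) / Qp ^ 4) := by
        field_simp
      have s2 : (ε ^ 2 + E) / Qp ^ 4 ≤ 1 / c ^ 2 + 81 * D := by
        rw [div_le_iff₀ (by positivity)]
        linarith
      have s3 : 2 * a ^ 2 * q ^ 2 * d ^ 2 * ((ε ^ 2 + E) / Qp ^ 4)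
          ≤ 2 * a ^ 2 * q ^ 2 * d ^ 2 * (1 / c ^ 2 + 81 * D) := by
        gcongr
      linarith
    have : C2 * d ^ 2 = 4 * a * q * (1 / c ^ 2 + 81 * D) * d ^ 2
        + 2 * a ^ 2 * q ^ 2 * (1 / c ^ 2 + 81 * D) * d ^ 2 := by rw [hC2]; ring
    have : 0 < C1 * d ^ 2 := by positivity
    linarith
  · -- transition case
    left
    have hQm3 : Qm ≤ 3 * d := by linarith
    have hQpd : Qp ≤ d := by linarith
    have s1 : ε ≤ 1 / c * d ^ 2 := by
      have : Qp ^ 2 ≤ d ^ 2 := pow_le_pow_left₀ hQpp.le hQpd 2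
      rw [div_mul_eq_mul_div, one_mul, le_div_iff₀ hcp]
      linarith
    have s2 : ε ^ 2 ≤ ε := by nlinarith [hε.2]
    have s3 : Qm ^ 4 ≤ 9 * d ^ 2 := by
      have i1 : Qm ^ 2 ≤ (3 * d) ^ 2 := pow_le_pow_left₀ hQmp.le hQm3 2
      have i2 : Qm ^ 2 ≤ 1 := by nlinarith
      have : Qm ^ 4 = Qm ^ 2 * Qm ^ 2 := by ring
      nlinarith [sq_nonneg Qm]
    have s4 : D * Qm ^ 4 ≤ D * (9 * d ^ 2) := by gcongr
    have : C1 * d ^ 2 = 2 * (1 / c * d ^ 2 + D * (9 * d ^ 2)) := by rw [hC1]; ring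
    have : 0 < C2 * d ^ 2 := by positivity
    linarith

lemma Good.mono {δ ε C C' d p x r : ℝ} (h : Good δ ε C d p x r) (hC : C ≤ C') :
    Good δ ε C' d p x r := by
  have : C * d ^ 2 ≤ C' * d ^ 2 := by gcongr
  rcases h with h | h
  · exact Or.inl (h.trans this)
  · exact Or.inr (h.trans this)

lemma Good.reflect {δ ε C d p x r : ℝ} (h : Good δ ε C d p x r) :
    Good δ ε C d (1 - r) (1 - x) (1 - p) := by
  unfold Good at *
  have e1 : 1 - (1 - p) = p := by ring
  have e2 : 1 - p - (1 - x) = x - p := by ring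
  have e3 : 1 - x - (1 - r) = r - x := by ring
  rw [e1, e2, e3, add_comm (Real.exp (-δ * (1 - r) / ε)), abs_sub_comm, add_comm ((r - x) ^ 2)]
  exact h

lemma mesh_good (q a δ : ℝ) (hq : q ∈ Ioo (0:ℝ) (1/2)) (ha : 0 < a) (hδ : 0 < δ) :
    ∃ C : ℝ, 0 < C ∧ ∀ ε ∈ Ioc (0:ℝ) 1, a * ε < q → ∀ n j : ℕ, j + 1 < n →
      Good δ ε C (1 / (n:ℝ)) (vulMesh a ε q n j) (vulMesh a ε q n (j + 1))
        (vulMesh a ε q n (j + 1 + 1)) := by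
  obtain ⟨C, hC, hcore⟩ := mesh_core q a δ hq ha hδ
  have hg : 0 < 1/2 - q := by linarith [hq.2]
  refine ⟨C + 6 / (1/2 - q) ^ 2, by positivity, ?_⟩
  intro ε hε heq n j hjn
  have hε0 : 0 < ε := hε.1
  have he : 0 < a * ε := mul_pos ha hε0
  have hn : (0:ℝ) < n := by exact_mod_cast (by omega : 0 < n)
  obtain ⟨d, hd⟩ : ∃ d, d = 1 / (n:ℝ) := ⟨_, rfl⟩
  obtain ⟨t, ht⟩ : ∃ t, t = ((j + 1 : ℕ) : ℝ) / n := ⟨_, rfl⟩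
  have hdp : 0 < d := by rw [hd]; positivity
  have hdn : d * n = 1 := by rw [hd]; field_simp
  have e0 : (j:ℝ) / n = t - d := by rw [ht, hd]; push_cast; ring
  have e2 : ((j + 1 + 1 : ℕ):ℝ) / n = t + d := by rw [ht, hd]; push_cast; ring
  unfold vulMesh
  rw [e0, e2, ← ht, ← hd]
  have htd : 0 ≤ t - d := by rw [← e0]; positivity
  have htd1 : t + d ≤ 1 := by
    rw [← e2, div_le_one hn]
    exact_mod_cast hjn
  have hmono := (vulLam_strictMono a ε q hq he heq).monotone
  have h6 : 0 < 6 / (1/2 - q) ^ 2 := by positivity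
  rcases le_or_gt d (1/2 - q) with hcase | hcase
  · rcases le_or_gt t (1/2) with h | h
    · exact (hcore ε hε heq d t hdp htd h hcase).mono (by linarith)
    · have := (hcore ε hε heq d (1 - t) hdp (by linarith) (by linarith) hcase).reflect
      rw [← vulLam_symm a ε q hq he heq, ← vulLam_symm a ε q hq he heq,
        ← vulLam_symm a ε q hq he heq] at this
      have i1 : 1 - (1 - t + d) = t - d := by ring
      have i2 : 1 - (1 - t) = t := by ring
      have i3 : 1 - (1 - t - d) = t + d := by ring
      rw [i1, i2, i3] at this
      exact this.mono (by linarith)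
  · left
    have b1 : 0 ≤ vulLam a ε q (t - d) := by
      have := hmono htd
      rwa [vulLam_zero a ε q hq he heq] at this
    have b2 : vulLam a ε q (t + d) ≤ 1 := by
      have := hmono htd1
      rwa [vulLam_one a ε q hq he heq] at this
    have x1 : Real.exp (-δ * vulLam a ε q (t - d) / ε) ≤ 1 := by
      rw [Real.exp_le_one_iff]
      apply div_nonpos_of_nonpos_of_nonneg _ hε0.le
      nlinarith
    have x2 : Real.exp (-δ * (1 - vulLam a ε q (t + d)) / ε) ≤ 1 := by
      rw [Real.exp_le_one_iff]
      apply div_nonpos_of_nonpos_of_nonneg _ hε0.le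
      nlinarith
    have x3 : ε ^ 2 ≤ 1 := by nlinarith [hε.2]
    have x4 : 6 ≤ 6 / (1/2 - q) ^ 2 * d ^ 2 := by
      rw [div_mul_eq_mul_div, le_div_iff₀ (by positivity)]
      have : (1/2 - q) ^ 2 ≤ d ^ 2 := pow_le_pow_left₀ hg.le hcase.le 2
      linarith
    have x5 : 0 < C * d ^ 2 := by positivity
    linarith

lemma lay_le_ends (δ ε p r s : ℝ) (hδ : 0 < δ) (hε : 0 < ε) (hs : s ∈ Ioo p r) :
    lay δ ε s ≤ Real.exp (-δ * p / ε) + Real.exp (-δ * (1 - r) / ε) := by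
  unfold lay
  have h1 : -δ * s ≤ -δ * p := by nlinarith [hs.1]
  have h2 : -δ * (1 - s) ≤ -δ * (1 - r) := by nlinarith [hs.2]
  gcongr

/-- truncation error of the solution at three consecutive nodes -/
lemma trunc_good (f : ℝ → ℝ → ℝ) (δ K ε C d : ℝ) (hδ : 0 < δ) (hK : 0 < K) (hε : 0 < ε)
    (u u1 g1 g2 : ℝ → ℝ)
    (H : Chain (fun s => ε ^ 2 * u s) (fun s => ε ^ 2 * u1 s) (fun s => f s (u s)) g1 g2)
    (hb : ∀ x ∈ Icc (0:ℝ) 1, |f x (u x)| ≤ K * (ε ^ 2 + lay δ ε x) ∧ 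
        |g1 x| ≤ K * (ε + lay δ ε x / ε) ∧ |g2 x| ≤ K * (1 + lay δ ε x / ε ^ 2))
    (p x r : ℝ) (hp : 0 ≤ p) (hpx : p < x) (hxr : x < r) (hr : r ≤ 1) (hG : Good δ ε C d p x r) :
    |ε ^ 2 * (2 / (r - p) * ((u r - u x) / (r - x) - (u x - u p) / (x - p))) - f x (u x)|
      ≤ K * (C * d ^ 2) := by
  unfold Good at hG
  set E := Real.exp (-δ * p / ε) + Real.exp (-δ * (1 - r) / ε) with hE
  have hlay : ∀ s ∈ Ioo p r, lay δ ε s ≤ E := fun s hs => lay_le_ends δ ε p r s hδ hε hs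
  have hI : ∀ s ∈ Ioo p r, s ∈ Icc (0:ℝ) 1 := fun s hs => ⟨by linarith [hs.1], by linarith [hs.2]⟩
  have i1 : x - (x - p) = p := by ring
  have i2 : x + (r - x) = r := by ring
  have i3 : x - p + (r - x) = r - p := by ring
  obtain ⟨t1, t2⟩ := trunc _ _ _ _ _ H x (x - p) (r - x) (K * (ε ^ 2 + E)) (K * (1 + E / ε ^ 2))
    (by linarith) (by linarith) (by linarith) (by linarith)
    (by
      rw [i1, i2]
      intro s hs
      refine (hb s (hI s hs)).1.trans ?_
      have := hlay s hs
      gcongr)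
    (by
      rw [i1, i2]
      intro s hs
      refine (hb s (hI s hs)).2.2.trans ?_
      have := hlay s hs
      gcongr)
  simp only [i1, i2, i3] at t1 t2
  have e : ε ^ 2 * (2 / (r - p) * ((u r - u x) / (r - x) - (u x - u p) / (x - p)))
    = 2 / (r - p) * ((ε ^ 2 * u r - ε ^ 2 * u x) / (r - x) - (ε ^ 2 * u x - ε ^ 2 * u p) / (x - p)) := by
    ring
  rw [e]
  have hxI : x ∈ Ioo p r := ⟨hpx, hxr⟩
  rcases hG with hG | hG
  · refine t1.trans ?_
    have : K * (2 * (ε ^ 2 + E)) ≤ K * (C * d ^ 2) := by gcongr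
    linarith
  · refine t2.trans ?_
    have h1 : |g1 x| ≤ K * (ε + E / ε) := by
      refine (hb x (hI x hxI)).2.1.trans ?_
      have := hlay x hxI
      gcongr
    have h2 : |r - x - (x - p)| * |g1 x| ≤ |r - x - (x - p)| * (K * (ε + E / ε)) := by gcongr
    have h3 := mul_le_mul_of_nonneg_left hG hK.le
    linarith

/-- the nonlinear discrete scheme on the Vulanović mesh has a
unique solution and converges ε-uniformly with order two. -/
theorem stmt_15 (f : ℝ → ℝ → ℝ) (c₀ : ℝ) (hc₀ : 0 < c₀)
    (hf : SmoothF f) (hfu : LowerF f c₀)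
    (q a : ℝ) (hq : q ∈ Ioo (0:ℝ) (1/2)) (ha : 0 < a)
    (hac : 2 ≤ a * c₀) :
    ∃ C : ℝ, 0 < C ∧
      ∀ ε ∈ Ioc (0:ℝ) 1, a * ε < q → ∀ n : ℕ, 2 ≤ n →
      ∀ u : ℝ → ℝ, IsSolution f ε u →
        (∃ y : ℕ → ℝ, NonlinScheme f ε (vulMesh a ε q n) n y) ∧
        (∀ y y' : ℕ → ℝ,
          NonlinScheme f ε (vulMesh a ε q n) n y →
          NonlinScheme f ε (vulMesh a ε q n) n y' →
          ∀ i ≤ n, y i = y' i) ∧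
        (∀ y : ℕ → ℝ,
          NonlinScheme f ε (vulMesh a ε q n) n y →
          ∀ i ≤ n,
            |u (vulMesh a ε q n i) - y i| ≤ C * ((n:ℝ) ^ 2)⁻¹) := by
  obtain ⟨K, hK, hap⟩ := apriori f c₀ hc₀ hf hfu
  obtain ⟨C, hC, hgood⟩ := mesh_good q a (c₀ / 2) hq ha (by positivity)
  refine ⟨K * C / c₀ ^ 2, by positivity, ?_⟩
  intro ε hε heq n hn u hu
  have hε0 : 0 < ε := hε.1
  have he : 0 < a * ε := mul_pos ha hε0
  have hn0 : (0:ℝ) < n := by exact_mod_cast (by omega : 0 < n)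
  have hsm := vulLam_strictMono a ε q hq he heq
  have hx : ∀ i < n, vulMesh a ε q n i < vulMesh a ε q n (i + 1) := by
    intro i _
    unfold vulMesh
    apply hsm
    gcongr
    simp
  have hx0 : vulMesh a ε q n 0 = 0 := by
    unfold vulMesh
    simpa using vulLam_zero a ε q hq he heq
  have hxn : vulMesh a ε q n n = 1 := by
    unfold vulMesh
    rw [div_self hn0.ne']
    exact vulLam_one a ε q hq he heq
  have hxI : ∀ i ≤ n, vulMesh a ε q n i ∈ Icc (0:ℝ) 1 := by
    intro i hi
    constructor
    · rw [← hx0]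
      unfold vulMesh
      apply hsm.monotone
      gcongr
      simp
    · rw [← hxn]
      unfold vulMesh
      apply hsm.monotone
      gcongr
  refine ⟨disc_exists f c₀ hc₀ hfu ε hε0 _ n (by omega) hx hxI, ?_, ?_⟩
  · intro y y' hy hy' i hi
    have key : ∀ v w : ℕ → ℝ, NonlinScheme f ε (vulMesh a ε q n) n v →
        NonlinScheme f ε (vulMesh a ε q n) n w → v i - w i ≤ 0 := by
      intro v w hv hw
      have := disc_stab f c₀ hc₀ hfu ε _ n hx hxI v w 0 le_rfl
        (fun j hj hjn => by rw [hv.1 j hj hjn, hw.1 j hj hjn]; simp)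
        (by rw [hv.2.1, hw.2.1]) (by rw [hv.2.2, hw.2.2]) i hi
      simpa using this
    have := key y y' hy hy'
    have := key y' y hy' hy
    linarith
  · intro y hy i hi
    obtain ⟨u1, g1, g2, H, hb⟩ := hap ε hε u hu
    have htau : ∀ j, 1 ≤ j → j < n →
        |ε ^ 2 * ddiff (vulMesh a ε q n) (fun i => u (vulMesh a ε q n i)) j
          - f (vulMesh a ε q n j) (u (vulMesh a ε q n j))| ≤ K * (C * (1 / (n:ℝ)) ^ 2) := by
      intro j hj hjn
      obtain ⟨k, rfl⟩ : ∃ k, j = k + 1 := ⟨j - 1, by omega⟩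
      unfold ddiff
      simp only [Nat.add_sub_cancel]
      exact trunc_good f (c₀ / 2) K ε C (1 / (n:ℝ)) (by positivity) hK hε0 u u1 g1 g2 H hb _ _ _
        (hxI k (by omega)).1 (hx k (by omega)) (hx (k + 1) hjn) (hxI (k + 1 + 1) (by omega)).2
        (hgood ε hε heq n k hjn)
    have hT : 0 ≤ K * (C * (1 / (n:ℝ)) ^ 2) := by positivity
    have u0 : u (vulMesh a ε q n 0) = 0 := by rw [hx0]; exact hu.2.2.1
    have un : u (vulMesh a ε q n n) = 0 := by rw [hxn]; exact hu.2.2.2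
    have s1 := disc_stab f c₀ hc₀ hfu ε _ n hx hxI (fun i => u (vulMesh a ε q n i)) y _ hT
      (fun j hj hjn => by
        have h1 := abs_le.1 (htau j hj hjn)
        have h2 := hy.1 j hj hjn
        rw [h2]
        linarith [h1.1]) (by rw [u0, hy.2.1]) (by rw [un, hy.2.2]) i hi
    have s2 := disc_stab f c₀ hc₀ hfu ε _ n hx hxI y (fun i => u (vulMesh a ε q n i)) _ hT
      (fun j hj hjn => by
        have h1 := abs_le.1 (htau j hj hjn)
        have h2 := hy.1 j hj hjn
        rw [h2]
        linarith [h1.2]) (by rw [u0, hy.2.1]) (by rw [un, hy.2.2]) i hi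
    have e : K * (C * (1 / (n:ℝ)) ^ 2) / c₀ ^ 2 = K * C / c₀ ^ 2 * ((n:ℝ) ^ 2)⁻¹ := by
      field_simp
    rw [e] at s1 s2
    rw [abs_le]
    constructor <;> linarith
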